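/- arXiv:1112.2227 — 6 statements merged into one kernel-verified Lean document; each statement's English description precedes it below -/
import Mathlib

section
/- Let Φ be a simple point process on ℝ^d with Radon mean measure α, and suppose Φ is α-weakly sub-Poisson. Then for every measurable response function ℓ: ℝ^d × ℝ^d → [0,∞) and every y ∈ ℝ^d, the additive shot-noise field V_Φ(y) = Σ_{X∈Φ} ℓ(X,y) satisfies E[e^{V_Φ(y)}] ≤ exp(∫_{ℝ^d} (e^{ℓ(x,y)} − 1) α(dx)). -/
open MeasureTheory ENNReal Metric

noncomputable section

/-- Extended exponential `e^x` on `ℝ≥0∞` (with `e^∞ = ∞`). -/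
def expE (x : ℝ≥0∞) : ℝ≥0∞ := if x = ∞ then ∞ else ENNReal.ofReal (Real.exp x.toReal)

/-- The additive shot-noise field `V_Φ(y) = Σ_{X ∈ Φ} ℓ(X, y)` generated by a
counting measure `μ` and a nonnegative response function `ℓ`. -/
def shotNoise {d : ℕ} (μ : Measure (EuclideanSpace ℝ (Fin d)))
    (ℓ : EuclideanSpace ℝ (Fin d) → EuclideanSpace ℝ (Fin d) → ℝ)
    (y : EuclideanSpace ℝ (Fin d)) : ℝ≥0∞ :=
  ∫⁻ x, ENNReal.ofReal (ℓ x y) ∂μ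

section ExpE

lemma expE_eq_ereal_exp (x : ℝ≥0∞) : expE x = EReal.exp (x : EReal) := by
  unfold expE
  split_ifs with h
  · simp [h]
  · conv_rhs => rw [← ENNReal.ofReal_toReal h]
    rw [EReal.coe_ennreal_ofReal, max_eq_left toReal_nonneg, EReal.exp_coe]

lemma continuous_expE : Continuous expE := by
  rw [funext expE_eq_ereal_exp]
  exact ENNReal.continuous_exp.comp continuous_coe_ennreal_ereal

lemma expE_mono : Monotone expE := fun a b h ↦ by
  simpa [expE_eq_ereal_exp] using h

lemma expE_zero : expE 0 = 1 := by simp [expE_eq_ereal_exp]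

lemma expE_add (x y : ℝ≥0∞) : expE (x + y) = expE x * expE y := by
  simp [expE_eq_ereal_exp, EReal.exp_add]

lemma expE_ofReal {r : ℝ} (hr : 0 ≤ r) :
    expE (ENNReal.ofReal r) = ENNReal.ofReal (Real.exp r) := by
  simp [expE, toReal_ofReal hr]

lemma expE_sum {ι : Type*} (s : Finset ι) (f : ι → ℝ≥0∞) :
    expE (∑ i ∈ s, f i) = ∏ i ∈ s, expE (f i) := by
  classical
  induction s using Finset.induction_on with
  | empty => simp [expE_zero]
  | insert a s ha ih => rw [Finset.sum_insert ha, Finset.prod_insert ha, expE_add, ih]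

lemma one_add_le_expE (x : ℝ≥0∞) : 1 + x ≤ expE x := by
  rcases eq_or_ne x ∞ with rfl | hx
  · simp [expE]
  · lift x to NNReal using hx
    rw [expE, if_neg coe_ne_top, ← ENNReal.ofReal_coe_nnreal, ← ENNReal.ofReal_one,
      ← ENNReal.ofReal_add zero_le_one x.coe_nonneg]
    refine ENNReal.ofReal_le_ofReal ?_
    rw [add_comm, toReal_ofReal x.coe_nonneg]
    exact Real.add_one_le_exp _

lemma one_le_expE (x : ℝ≥0∞) : 1 ≤ expE x := le_self_add.trans (one_add_le_expE x)

end ExpE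

/-- Fatou's lemma for a convergent sequence with uniformly bounded integrals. -/
lemma lintegral_le_of_tendsto_of_le {Ω : Type*} [MeasurableSpace Ω] {P : Measure Ω}
    {F : ℕ → Ω → ℝ≥0∞} {G : Ω → ℝ≥0∞} {C : ℝ≥0∞} (hF : ∀ n, Measurable (F n))
    (hlim : ∀ᵐ ω ∂P, Filter.Tendsto (fun n ↦ F n ω) Filter.atTop (nhds (G ω)))
    (hC : ∀ n, ∫⁻ ω, F n ω ∂P ≤ C) : ∫⁻ ω, G ω ∂P ≤ C :=
  calc ∫⁻ ω, G ω ∂P = ∫⁻ ω, Filter.liminf (fun n ↦ F n ω) Filter.atTop ∂P :=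
        lintegral_congr_ae (hlim.mono fun _ h ↦ h.liminf_eq.symm)
    _ ≤ Filter.liminf (fun n ↦ ∫⁻ ω, F n ω ∂P) Filter.atTop := lintegral_liminf_le hF
    _ ≤ Filter.liminf (fun _ : ℕ ↦ C) Filter.atTop :=
        Filter.liminf_le_liminf (Filter.Eventually.of_forall hC)
    _ = C := Filter.liminf_const C

section Metric

variable {X : Type*} [MetricSpace X] [ProperSpace X] [MeasurableSpace X] [BorelSpace X]

/-- A compact set is uniformly approximated by the values of a simple function. -/
lemma exists_simpleFunc_dist_lt [Nonempty X] {K : Set X} (hK : IsCompact K) {δ : ℝ} (hδ : 0 < δ) :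
    ∃ p : SimpleFunc X X, ∀ x ∈ K, dist (p x) x < δ := by
  let e := TopologicalSpace.denseSeq X
  obtain ⟨t, ht⟩ := hK.elim_finite_subcover (fun i : ℕ ↦ ball (e i) δ) (fun _ ↦ isOpen_ball)
    fun x _ ↦ by
      obtain ⟨i, hi⟩ := (TopologicalSpace.denseRange_denseSeq X).exists_dist_lt x hδ
      exact Set.mem_iUnion.2 ⟨i, hi⟩
  refine ⟨SimpleFunc.nearestPt e (t.sup id), fun x hx ↦ ?_⟩
  obtain ⟨i, hit, hi⟩ := Set.mem_iUnion₂.1 (ht hx)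
  rw [← edist_lt_ofReal]
  refine (SimpleFunc.edist_nearestPt_le e x (Finset.le_sup (f := id) hit)).trans_lt ?_
  rwa [edist_lt_ofReal, dist_comm]

/-- A simple integer-valued measure charges sufficiently small subsets of a compact set with mass
at most one. -/
lemma exists_pos_forall_measure_eq_zero_or_one {μ : Measure X}
    (hcount : ∀ B, MeasurableSet B → Bornology.IsBounded B → ∃ n : ℕ, μ B = n)
    (hsimple : ∀ x, μ {x} ≤ 1) {K : Set X} (hK : IsCompact K) :
    ∃ δ > 0, ∀ B ⊆ K, MeasurableSet B → (∀ x ∈ B, ∀ y ∈ B, dist x y < δ) → μ B = 0 ∨ μ B = 1 := by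
  have : IsLocallyFiniteMeasure μ := ⟨fun x ↦ ⟨ball x 1, ball_mem_nhds x one_pos, by
    obtain ⟨n, hn⟩ := hcount _ measurableSet_ball (isBounded_ball (x := x) (r := 1))
    simp [hn]⟩⟩
  have hU (x : X) : ∃ U, {x} ⊆ U ∧ IsOpen U ∧ μ U < 2 :=
    Set.exists_isOpen_lt_of_lt {x} 2 ((hsimple x).trans_lt one_lt_two)
  choose U hxU hUo hU2 using hU
  obtain ⟨δ, hδ, h⟩ := lebesgue_number_lemma_of_metric hK hUo
    fun x _ ↦ Set.mem_iUnion.2 ⟨x, hxU x rfl⟩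
  refine ⟨δ, hδ, fun B hBK hBm hB ↦ ?_⟩
  rcases B.eq_empty_or_nonempty with rfl | ⟨x, hx⟩
  · simp
  obtain ⟨i, hi⟩ := h x (hBK hx)
  obtain ⟨n, hn⟩ := hcount B hBm (hK.isBounded.subset hBK)
  have hlt : μ B < 2 := (measure_mono fun z hz ↦ hi (hB z hz x hx)).trans_lt (hU2 i)
  rw [hn] at hlt ⊢
  have : n < 2 := by exact_mod_cast hlt
  interval_cases n <;> simp

end Metric

section SubPoisson

variable {X Ω : Type*} [MeasurableSpace X] [MeasurableSpace Ω]

/-- The integral of the second component of a paired simple function is a sum over the cells of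
the pair. -/
lemma setLIntegral_eq_sum_pair {β : Type*} (μ : Measure X) (p : SimpleFunc X β)
    (g : SimpleFunc X ℝ≥0∞) (f : ℝ≥0∞ → ℝ≥0∞) {K : Set X} :
    ∫⁻ x in K, f (g x) ∂μ
      = ∑ c ∈ (p.pair g).range, f c.2 * μ (p.pair g ⁻¹' {c} ∩ K) := by
  have h : (fun x ↦ f (g x)) = (p.pair g).map fun c ↦ f c.2 := rfl
  rw [h, SimpleFunc.lintegral_eq_lintegral, SimpleFunc.map_lintegral]
  exact Finset.sum_congr rfl fun c _ ↦ by
    rw [Measure.restrict_apply (SimpleFunc.measurableSet_fiber _ _)]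

/-- Negative correlation of the counts in disjoint sets gives a product bound for their
generating functional. -/
lemma lintegral_prod_one_add_le {P : Measure Ω} {Φ : Ω → Measure X} (hΦ : Measurable Φ)
    {α : Measure X} (hmean : ∀ B, MeasurableSet B → α B = ∫⁻ ω, Φ ω B ∂P) {p : Set X → Prop}
    (hsub : ∀ (k : ℕ) (B : Fin k → Set X), (∀ i, MeasurableSet (B i) ∧ p (B i)) →
      Pairwise (Function.onFun Disjoint B) →
      ∫⁻ ω, ∏ i, Φ ω (B i) ∂P ≤ ∏ i, ∫⁻ ω, Φ ω (B i) ∂P) [IsProbabilityMeasure P]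
    {ι : Type*} (s : Finset ι) (B : ι → Set X) (a : ι → ℝ≥0∞)
    (hB : ∀ i, MeasurableSet (B i) ∧ p (B i)) (hdisj : Pairwise (Function.onFun Disjoint B)) :
    ∫⁻ ω, ∏ i ∈ s, (1 + a i * Φ ω (B i)) ∂P ≤ ∏ i ∈ s, (1 + a i * α (B i)) := by
  classical
  have hm (i : ι) : Measurable fun ω ↦ Φ ω (B i) := (Measure.measurable_coe (hB i).1).comp hΦ
  simp_rw [Finset.prod_one_add, Finset.prod_mul_distrib]
  rw [lintegral_finsetSum _ fun t _ ↦ (Finset.measurable_prod _ fun i _ ↦ hm i).const_mul _]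
  refine Finset.sum_le_sum fun t _ ↦ ?_
  rw [lintegral_const_mul _ (Finset.measurable_prod _ fun i _ ↦ hm i)]
  gcongr
  have hprod (f : ι → ℝ≥0∞) : ∏ i ∈ t, f i = ∏ j, f (t.equivFin.symm j) := by
    rw [← Finset.prod_coe_sort, ← t.equivFin.symm.prod_comp]
  simp_rw [hprod]
  refine (hsub _ (fun j ↦ B (t.equivFin.symm j)) (fun j ↦ hB _) fun i j hij ↦ hdisj ?_).trans ?_
  · simpa [Subtype.coe_inj] using hij
  · simp_rw [hmean _ (hB _).1]
    rfl

end SubPoisson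

/-- The exponential moment bound for a simple response function restricted to a compact set. -/
lemma lintegral_expE_setLIntegral_simpleFunc_le {X Ω : Type*} [MetricSpace X] [ProperSpace X]
    [MeasurableSpace X] [BorelSpace X] [Nonempty X] [MeasurableSpace Ω]
    {P : Measure Ω} [IsProbabilityMeasure P] {Φ : Ω → Measure X} (hΦ : Measurable Φ)
    (hcount : ∀ᵐ ω ∂P, ∀ B : Set X,
      MeasurableSet B → Bornology.IsBounded B → ∃ n : ℕ, Φ ω B = n)
    (hsimple : ∀ᵐ ω ∂P, ∀ x, Φ ω {x} ≤ 1)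
    {α : Measure X} (hmean : ∀ B, MeasurableSet B → α B = ∫⁻ ω, Φ ω B ∂P)
    (hsub : ∀ (k : ℕ) (B : Fin k → Set X),
      (∀ i, MeasurableSet (B i) ∧ Bornology.IsBounded (B i)) →
      Pairwise (Function.onFun Disjoint B) →
      ∫⁻ ω, ∏ i, Φ ω (B i) ∂P ≤ ∏ i, ∫⁻ ω, Φ ω (B i) ∂P)
    (g : SimpleFunc X ℝ≥0∞) {K : Set X} (hK : IsCompact K) :
    ∫⁻ ω, expE (∫⁻ x in K, g x ∂Φ ω) ∂P ≤ expE (∫⁻ x in K, (expE (g x) - 1) ∂α) := by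
  choose p hp using fun n : ℕ ↦
    exists_simpleFunc_dist_lt hK (Nat.one_div_pos_of_nat (α := ℝ) (n := n))
  let cell (n : ℕ) (c : X × ℝ≥0∞) : Set X := (p n).pair g ⁻¹' {c} ∩ K
  have hcell (n c) : MeasurableSet (cell n c) ∧ Bornology.IsBounded (cell n c) :=
    ⟨(SimpleFunc.measurableSet_fiber _ _).inter hK.measurableSet,
      hK.isBounded.subset Set.inter_subset_right⟩
  have hdisj (n) : Pairwise (Function.onFun Disjoint (cell n)) := fun c c' hne ↦
    ((Set.disjoint_singleton.2 hne).preimage _).mono Set.inter_subset_left Set.inter_subset_left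
  refine lintegral_le_of_tendsto_of_le
    (F := fun n ω ↦ ∏ c ∈ ((p n).pair g).range, (1 + (expE c.2 - 1) * Φ ω (cell n c)))
    (fun n ↦ Finset.measurable_prod _ fun c _ ↦
      (((Measure.measurable_coe (hcell n c).1).comp hΦ).const_mul _).const_add _) ?_ fun n ↦ ?_
  · filter_upwards [hcount, hsimple] with ω hω hω'
    obtain ⟨δ, hδ, h⟩ := exists_pos_forall_measure_eq_zero_or_one hω hω' hK
    refine tendsto_const_nhds.congr' ?_
    filter_upwards [tendsto_one_div_add_atTop_nhds_zero_nat.eventually_lt_const (half_pos hδ)]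
      with n hn
    rw [setLIntegral_eq_sum_pair (Φ ω) (p n) g fun a ↦ a, expE_sum]
    refine Finset.prod_congr rfl fun c _ ↦ ?_
    have hsmall : ∀ x ∈ cell n c, ∀ y ∈ cell n c, dist x y < δ := by
      rintro x ⟨hx, hxK⟩ y ⟨hy, hyK⟩
      have hpx : p n x = c.1 := congrArg Prod.fst hx
      have hpy : p n y = c.1 := congrArg Prod.fst hy
      have h₁ := hp n x hxK
      have h₂ := hp n y hyK
      rw [hpx] at h₁
      rw [hpy] at h₂
      linarith [dist_triangle_left x y c.1]
    rcases h _ Set.inter_subset_right (hcell n c).1 hsmall with h0 | h1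
    · rw [h0, mul_zero, mul_zero, expE_zero, add_zero]
    · rw [h1, mul_one, mul_one, add_tsub_cancel_of_le (one_le_expE _)]
  · refine (lintegral_prod_one_add_le hΦ hmean hsub _ (cell n) _ (hcell n) (hdisj n)).trans ?_
    rw [setLIntegral_eq_sum_pair α (p n) g fun a ↦ expE a - 1, expE_sum]
    exact Finset.prod_le_prod' fun c _ ↦ one_add_le_expE _

/-- if a simple point process `Φ` with Radon mean measure `α` is
α-weakly sub-Poisson, then `E[e^{V_Φ(y)}] ≤ exp(∫ (e^{ℓ(x,y)} − 1) α(dx))`. -/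
theorem expMoment_shotNoise_le_of_alphaWeaklySubPoisson
    {d : ℕ} {Ω : Type*} [MeasurableSpace Ω] (P : Measure Ω) [IsProbabilityMeasure P]
    (Φ : Ω → Measure (EuclideanSpace ℝ (Fin d)))
    (hΦmeas : Measurable Φ)
    -- `Φ` is a point process: almost surely a Radon counting measure
    (hcount : ∀ᵐ ω ∂P, ∀ B : Set (EuclideanSpace ℝ (Fin d)),
      MeasurableSet B → Bornology.IsBounded B → ∃ n : ℕ, Φ ω B = n)
    -- `Φ` is simple
    (hsimple : ∀ᵐ ω ∂P, ∀ x, Φ ω {x} ≤ 1)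
    -- `α` is the mean measure of `Φ`, assumed Radon
    (α : Measure (EuclideanSpace ℝ (Fin d)))
    (hmean : ∀ B : Set (EuclideanSpace ℝ (Fin d)), MeasurableSet B → α B = ∫⁻ ω, Φ ω B ∂P)
    (hRadon : ∀ B : Set (EuclideanSpace ℝ (Fin d)), Bornology.IsBounded B → α B < ∞)
    -- `Φ` is α-weakly sub-Poisson
    (hsub : ∀ (k : ℕ) (B : Fin k → Set (EuclideanSpace ℝ (Fin d))),
      (∀ i, MeasurableSet (B i) ∧ Bornology.IsBounded (B i)) →
      Pairwise (Function.onFun Disjoint B) →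
      ∫⁻ ω, ∏ i, Φ ω (B i) ∂P ≤ ∏ i, ∫⁻ ω, Φ ω (B i) ∂P)
    -- measurable nonnegative response function
    (ℓ : EuclideanSpace ℝ (Fin d) → EuclideanSpace ℝ (Fin d) → ℝ)
    (hℓmeas : Measurable (Function.uncurry ℓ))
    (hℓ0 : ∀ x y, 0 ≤ ℓ x y)
    (y : EuclideanSpace ℝ (Fin d)) :
    ∫⁻ ω, expE (shotNoise (Φ ω) ℓ y) ∂P
      ≤ expE (∫⁻ x, ENNReal.ofReal (Real.exp (ℓ x y) - 1) ∂α) := by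
  let h (x : EuclideanSpace ℝ (Fin d)) : ℝ≥0∞ := ENNReal.ofReal (ℓ x y)
  have hh : Measurable h :=
    ENNReal.measurable_ofReal.comp (hℓmeas.comp (measurable_id.prodMk measurable_const))
  let K (n : ℕ) : Set (EuclideanSpace ℝ (Fin d)) := closedBall 0 n
  have hind (n : ℕ) (μ : Measure (EuclideanSpace ℝ (Fin d))) :
      ∫⁻ x in K n, SimpleFunc.eapprox h n x ∂μ
        = ∫⁻ x, (K n).indicator (SimpleFunc.eapprox h n) x ∂μ :=
    (lintegral_indicator measurableSet_closedBall _).symm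
  have hV (μ : Measure (EuclideanSpace ℝ (Fin d))) :
      Filter.Tendsto (fun n ↦ ∫⁻ x in K n, SimpleFunc.eapprox h n x ∂μ) Filter.atTop
        (nhds (∫⁻ x, h x ∂μ)) := by
    simp_rw [hind]
    refine lintegral_tendsto_of_tendsto_of_monotone
      (fun n ↦ ((SimpleFunc.measurable _).indicator measurableSet_closedBall).aemeasurable)
      (Filter.Eventually.of_forall fun x m n hmn ↦ ?_) (Filter.Eventually.of_forall fun x ↦ ?_)
    · exact Set.indicator_le_indicator_of_subset
        (closedBall_subset_closedBall (Nat.cast_le.2 hmn)) (fun _ ↦ zero_le) x |>.trans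
        (Set.indicator_le_indicator (SimpleFunc.monotone_eapprox h hmn x))
    · refine (SimpleFunc.tendsto_eapprox hh x).congr' ?_
      filter_upwards [Filter.eventually_ge_atTop ⌈‖x‖⌉₊] with n hn
      rw [Set.indicator_of_mem (mem_closedBall_zero_iff.2 (Nat.ceil_le.1 hn))]
  refine lintegral_le_of_tendsto_of_le
    (F := fun n ω ↦ expE (∫⁻ x in K n, SimpleFunc.eapprox h n x ∂Φ ω))
    (fun n ↦ continuous_expE.measurable.comp ?_)
    (Filter.Eventually.of_forall fun ω ↦ (continuous_expE.tendsto _).comp (hV (Φ ω))) fun n ↦ ?_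
  · simp_rw [hind]
    exact (Measure.measurable_lintegral
      ((SimpleFunc.measurable _).indicator measurableSet_closedBall)).comp hΦmeas
  · refine (lintegral_expE_setLIntegral_simpleFunc_le hΦmeas hcount hsimple hmean hsub _
      (isCompact_closedBall 0 (n : ℝ))).trans (expE_mono ?_)
    refine (setLIntegral_le_lintegral _ _).trans (lintegral_mono fun x ↦ ?_)
    rw [ENNReal.ofReal_sub _ zero_le_one, ENNReal.ofReal_one, ← expE_ofReal (hℓ0 x y)]
    refine tsub_le_tsub_right (expE_mono ?_) 1
    exact (le_iSup _ n).trans_eq (SimpleFunc.iSup_eapprox_apply hh x)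
end
end

section
/- Independent thinning preserves the ordering of void probabilities of simple point processes: let Φ and Ψ be simple point processes on ℝ^d such that P(Φ(B) = 0) ≤ P(Ψ(B) = 0) for every bounded Borel set B. Fix disjoint bounded Borel sets B_1,…,B_k and retention probabilities p_1,…,p_k ∈ [0,1], and let Φ' (respectively Ψ') be obtained from Φ (respectively Ψ) by independently retaining each point lying in B_i with probability p_i and deleting all points outside ∪_i B_i. Then P(Φ'(B) = 0) ≤ P(Ψ'(B) = 0) for every bounded Borel set B. -/
open MeasureTheory ENNReal Metric

noncomputable section

open Filter Topology in
/-- A sequence of natural numbers converging in `ℝ≥0∞` to a natural number is eventually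
constant. -/
lemma eventually_eq_of_tendsto_natCast {u : ℕ → ℕ} {m : ℕ}
    (h : Tendsto (fun n ↦ (u n : ℝ≥0∞)) atTop (𝓝 (m : ℝ≥0∞))) :
    ∀ᶠ n in atTop, u n = m := by
  have h_le : ∀ᶠ n in atTop, u n ≤ m := by
    filter_upwards [h.eventually_lt_const
      (show (m : ℝ≥0∞) < ((m + 1 : ℕ) : ℝ≥0∞) by exact_mod_cast m.lt_succ_self)] with n hn
    exact Nat.lt_succ_iff.1 (by exact_mod_cast hn)
  have h_ge : ∀ᶠ n in atTop, m ≤ u n := by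
    cases m with
    | zero => simp
    | succ m =>
      filter_upwards [h.eventually_const_lt
        (show (m : ℝ≥0∞) < ((m + 1 : ℕ) : ℝ≥0∞) by exact_mod_cast m.lt_succ_self)] with n hn
      exact Nat.succ_le_of_lt (by exact_mod_cast hn)
  filter_upwards [h_le, h_ge] with n h₁ h₂ using le_antisymm h₁ h₂

section CountablePartition

open Filter Topology MeasurableSpace

variable {E : Type*} [MeasurableSpace E] [CountablyGenerated E]

lemma antitone_countablePartitionSet (x : E) : Antitone fun n ↦ countablePartitionSet n x := by
  classical
  refine antitone_nat_of_succ_le fun n ↦ ?_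
  rw [countablePartitionSet, memPartitionSet_succ]
  split_ifs
  · exact Set.inter_subset_left
  · exact Set.sdiff_subset

lemma iInter_countablePartitionSet [SeparatesPoints E] (x : E) :
    ⋂ n, countablePartitionSet n x = {x} := by
  refine Set.Subset.antisymm (fun y hy ↦ ?_)
    (by simpa using fun n ↦ mem_countablePartitionSet n x)
  have : SeparatesPoints E := inferInstance
  rw [← generateFrom_iUnion_countablePartition E] at this
  refine separating_of_generateFrom (⋃ n, countablePartition E n) y x fun u hu ↦ ?_
  obtain ⟨n, hn⟩ := Set.mem_iUnion.1 hu
  have hxy : countablePartitionSet n y = countablePartitionSet n x :=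
    countablePartitionSet_of_mem (countablePartitionSet_mem n x) (Set.mem_iInter.1 hy n)
  rw [← countablePartitionSet_eq_iff y hn, ← countablePartitionSet_eq_iff x hn, hxy]

open Classical in
/-- For a finite simple counting measure, the number of cells of the `n`-th countable partition
that carry mass is eventually the total mass. -/
lemma eventually_card_countablePartition_ne_zero_eq [SeparatesPoints E] (μ : Measure E)
    (hcount : ∀ B, MeasurableSet B → ∃ n : ℕ, μ B = n) (hsimple : ∀ x, μ {x} ≤ 1) :
    ∀ᶠ n in atTop,
      (((finite_countablePartition E n).toFinset.filter (μ · ≠ 0)).card : ℝ≥0∞)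
        = μ Set.univ := by
  have hfin : IsFiniteMeasure μ := by
    obtain ⟨n, hn⟩ := hcount _ .univ
    exact ⟨by simp [hn]⟩
  have hsing : MeasurableSingletonClass E := measurableSingletonClass_of_countablySeparated
  set g : ℕ → E → ℝ≥0∞ := fun n x ↦
    ∑ D ∈ (finite_countablePartition E n).toFinset, D.indicator (fun _ ↦ (μ D)⁻¹) x with hg
  have hg_eq (n : ℕ) (x : E) : g n x = (μ (countablePartitionSet n x))⁻¹ := by
    rw [hg]
    dsimp only
    rw [Finset.sum_eq_single (countablePartitionSet n x)]
    · rw [Set.indicator_of_mem (mem_countablePartitionSet n x)]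
    · intro D hD hne
      refine Set.indicator_of_notMem (fun hx ↦ hne ?_) _
      exact (countablePartitionSet_of_mem (by simpa using hD) hx).symm
    · intro h
      exact absurd (by simpa using countablePartitionSet_mem n x) h
  have hmeas (n : ℕ) : Measurable (g n) := by
    refine Finset.measurable_sum _ fun D hD ↦ measurable_const.indicator ?_
    exact measurableSet_countablePartition n (by simpa using hD)
  have hint (n : ℕ) : ∫⁻ x, g n x ∂μ
      = (((finite_countablePartition E n).toFinset.filter (μ · ≠ 0)).card : ℝ≥0∞) := by
    have hD {D : Set E} (h : D ∈ (finite_countablePartition E n).toFinset) : MeasurableSet D :=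
      measurableSet_countablePartition n (by simpa using h)
    rw [lintegral_finsetSum _ fun D h ↦ measurable_const.indicator (hD h), Finset.card_filter,
      Nat.cast_sum]
    refine Finset.sum_congr rfl fun D h ↦ ?_
    rw [lintegral_indicator_const (hD h)]
    by_cases h0 : μ D = 0
    · simp [h0]
    · simp [h0, ENNReal.inv_mul_cancel h0 (measure_ne_top μ D)]
  have hpos : ∀ᵐ x ∂μ, ∀ n, μ (countablePartitionSet n x) ≠ 0 := by
    rw [ae_all_iff]
    intro n
    have hnull : μ (⋃ D ∈ {D ∈ countablePartition E n | μ D = 0}, D) = 0 :=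
      (measure_biUnion_null_iff
        ((finite_countablePartition E n).subset (Set.sep_subset _ _)).countable).2
        fun D hD ↦ hD.2
    refine measure_mono_null (fun x hx ↦ ?_) hnull
    simp only [Set.mem_iUnion]
    exact ⟨countablePartitionSet n x, ⟨countablePartitionSet_mem n x, by simpa using hx⟩,
      mem_countablePartitionSet n x⟩
  have hone_le {B : Set E} (hB : MeasurableSet B) (h0 : μ B ≠ 0) : 1 ≤ μ B := by
    obtain ⟨m, hm⟩ := hcount B hB
    rw [hm] at h0 ⊢
    exact_mod_cast Nat.one_le_iff_ne_zero.2 (by exact_mod_cast h0)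
  have hlim : Tendsto (fun n ↦ ∫⁻ x, g n x ∂μ) atTop (𝓝 (∫⁻ _, 1 ∂μ)) := by
    refine tendsto_lintegral_of_dominated_convergence 1 hmeas (fun n ↦ ?_) (by simp) ?_
    · filter_upwards [hpos] with x hx
      rw [hg_eq, Pi.one_apply, ENNReal.inv_le_one]
      exact hone_le (measurableSet_countablePartitionSet n x) (hx n)
    · filter_upwards [hpos] with x hx
      have ht := tendsto_measure_iInter_atTop (μ := μ)
        (fun n ↦ (measurableSet_countablePartitionSet n x).nullMeasurableSet)
        (antitone_countablePartitionSet x) ⟨0, measure_ne_top _ _⟩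
      rw [iInter_countablePartitionSet] at ht
      have hx1 : μ {x} = 1 := (hsimple x).antisymm <| ge_of_tendsto' ht fun n ↦
        hone_le (measurableSet_countablePartitionSet n x) (hx n)
      rw [hx1] at ht
      simpa [hg_eq, Function.comp_def] using ht.inv
  simp only [hint, lintegral_one] at hlim
  obtain ⟨m, hm⟩ := hcount _ .univ
  rw [hm] at hlim ⊢
  filter_upwards [eventually_eq_of_tendsto_natCast hlim] with n hn
  rw [hn]

open Classical in
/-- The probability generating functional of a simple point process, for a weight `q i` on each
set `A i`, is the limit of its discretizations along the countable partitions of the space. -/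
lemma tendsto_lintegral_prod_countablePartition [SeparatesPoints E]
    {Ω : Type*} [MeasurableSpace Ω] (P : Measure Ω) [IsFiniteMeasure P]
    {Φ : Ω → Measure E} (hΦ : Measurable Φ) {ι : Type*} [Fintype ι] {A : ι → Set E}
    (hA : ∀ i, MeasurableSet (A i))
    (hcount : ∀ᵐ ω ∂P, ∀ i, ∀ B, MeasurableSet B → ∃ n : ℕ, Φ ω (B ∩ A i) = n)
    (hsimple : ∀ᵐ ω ∂P, ∀ x, Φ ω {x} ≤ 1) {q : ι → ℝ≥0∞} (hq : ∀ i, q i ≤ 1) :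
    Tendsto (fun n ↦ ∫⁻ ω, ∏ j ∈ Finset.univ ×ˢ (finite_countablePartition E n).toFinset,
        (if Φ ω (j.2 ∩ A j.1) = 0 then 1 else q j.1) ∂P) atTop
      (𝓝 (∫⁻ ω, ∏ i, q i ^ (Φ ω (A i)).toReal ∂P)) := by
  refine tendsto_lintegral_of_dominated_convergence 1 (fun n ↦ ?_) (fun n ↦ ?_) (by simp) ?_
  · refine Finset.measurable_prod _ fun j hj ↦ Measurable.ite ?_ measurable_const measurable_const
    have hj' : MeasurableSet j.2 :=
      measurableSet_countablePartition n (by simpa using hj)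
    exact (Measure.measurable_coe (hj'.inter (hA j.1))).comp hΦ (measurableSet_singleton 0)
  · refine Eventually.of_forall fun ω ↦ Finset.prod_le_one' fun j _ ↦ ?_
    split_ifs
    exacts [le_rfl, hq _]
  · filter_upwards [hcount, hsimple] with ω hc hs
    refine tendsto_nhds_of_eventually_eq ?_
    have hcard (i : ι) := eventually_card_countablePartition_ne_zero_eq ((Φ ω).restrict (A i))
      (fun B hB ↦ by simpa [Measure.restrict_apply hB] using hc i B hB)
      (fun x ↦ (Measure.restrict_apply_le _ _).trans (hs x))
    filter_upwards [eventually_all.2 hcard] with n hn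
    rw [Finset.prod_product]
    refine Finset.prod_congr rfl fun i _ ↦ ?_
    have hi := hn i
    rw [Measure.restrict_apply_univ] at hi
    dsimp only
    rw [Finset.prod_ite, Finset.prod_const_one, one_mul, Finset.prod_const, ← hi,
      ENNReal.toReal_natCast, ENNReal.rpow_natCast]
    congr 2
    refine Finset.filter_congr fun D hD ↦ ?_
    rw [Measure.restrict_apply (measurableSet_countablePartition n (by simpa using hD))]

end CountablePartition

open Classical in
/-- If the cells `c j`, `j ∈ J`, are selected independently with probabilities `p j`, averaging the
void probability of the union of the selected cells gives the right-hand side. -/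
lemma prod_ite_measure_eq_zero {E ι : Type*} [MeasurableSpace E] (μ : Measure E) (J : Finset ι)
    (c : ι → Set E) {p q : ι → ℝ≥0∞} (hpq : ∀ j, p j + q j = 1) :
    ∏ j ∈ J, (if μ (c j) = 0 then 1 else q j) =
      ∑ T ∈ J.powerset, ((∏ j ∈ T, p j) * ∏ j ∈ J \ T, q j) *
        if μ (⋃ j ∈ T, c j) = 0 then 1 else 0 := by
  have h (j : ι) : (if μ (c j) = 0 then 1 else q j)
      = p j * (if μ (c j) = 0 then 1 else 0) + q j := by
    split_ifs <;> simp [hpq]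
  simp_rw [h, Finset.prod_add]
  refine Finset.sum_congr rfl fun T _ ↦ ?_
  have h0 : μ (⋃ j ∈ T, c j) = 0 ↔ ∀ j ∈ T, μ (c j) = 0 :=
    measure_biUnion_null_iff T.countable_toSet
  rw [Finset.prod_mul_distrib, Finset.prod_ite_zero, Finset.prod_const_one]
  simp only [h0]
  ring

open Classical in
/-- The discretized probability generating functional is a nonnegative combination of void
probabilities. -/
lemma lintegral_prod_ite_eq {E : Type*} [MeasurableSpace E]
    {Ω : Type*} [MeasurableSpace Ω] (P : Measure Ω) {Φ : Ω → Measure E} (hΦ : Measurable Φ)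
    {ι : Type*} (J : Finset ι) {c : ι → Set E} (hc : ∀ j ∈ J, MeasurableSet (c j))
    {p q : ι → ℝ≥0∞} (hpq : ∀ j, p j + q j = 1) :
    ∫⁻ ω, ∏ j ∈ J, (if Φ ω (c j) = 0 then 1 else q j) ∂P
      = ∑ T ∈ J.powerset, ((∏ j ∈ T, p j) * ∏ j ∈ J \ T, q j) *
        P {ω | Φ ω (⋃ j ∈ T, c j) = 0} := by
  have hm {T : Finset ι} (hT : T ∈ J.powerset) :
      MeasurableSet {ω | Φ ω (⋃ j ∈ T, c j) = 0} :=
    (Measure.measurable_coe (T.measurableSet_biUnion fun j hj ↦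
      hc j (Finset.mem_powerset.1 hT hj))).comp hΦ (measurableSet_singleton 0)
  have hi {T : Finset ι} (hT : T ∈ J.powerset) :
      Measurable fun ω ↦ if Φ ω (⋃ j ∈ T, c j) = 0 then (1 : ℝ≥0∞) else 0 :=
    Measurable.ite (hm hT) measurable_const measurable_const
  simp_rw [prod_ite_measure_eq_zero _ J c hpq]
  rw [lintegral_finsetSum _ fun T hT ↦ (hi hT).const_mul _]
  refine Finset.sum_congr rfl fun T hT ↦ ?_
  rw [lintegral_const_mul _ (hi hT), ← lintegral_indicator_one (hm hT)]
  simp only [Set.indicator_apply, Set.mem_ofPred_eq, Pi.one_apply]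

open Classical in
/-- Ordering of void probabilities implies ordering of the discretized probability generating
functionals. -/
lemma lintegral_prod_ite_le {E : Type*} [MeasurableSpace E]
    {Ω : Type*} [MeasurableSpace Ω] (P : Measure Ω) {Φ : Ω → Measure E} (hΦ : Measurable Φ)
    {Ω' : Type*} [MeasurableSpace Ω'] (P' : Measure Ω') {Ψ : Ω' → Measure E} (hΨ : Measurable Ψ)
    {ι : Type*} (J : Finset ι) {c : ι → Set E} (hc : ∀ j ∈ J, MeasurableSet (c j))
    (hvoid : ∀ T ⊆ J, P {ω | Φ ω (⋃ j ∈ T, c j) = 0} ≤ P' {ω | Ψ ω (⋃ j ∈ T, c j) = 0})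
    {p q : ι → ℝ≥0∞} (hpq : ∀ j, p j + q j = 1) :
    ∫⁻ ω, ∏ j ∈ J, (if Φ ω (c j) = 0 then 1 else q j) ∂P
      ≤ ∫⁻ ω, ∏ j ∈ J, (if Ψ ω (c j) = 0 then 1 else q j) ∂P' := by
  rw [lintegral_prod_ite_eq P hΦ J hc hpq, lintegral_prod_ite_eq P' hΨ J hc hpq]
  gcongr with T hT
  exact hvoid T (Finset.mem_powerset.1 hT)

/-- independent thinning preserves the ordering of void probabilities of
simple point processes.  The thinning retains, independently, each point lying in the
(disjoint, bounded Borel) set `B i` with probability `p i`, and deletes all points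
outside `⋃ i, B i`.  Its void probabilities are given by the standard formula
`P(Φ'(C) = 0) = E[∏ i (1 − p i)^{Φ(C ∩ B i)}]`, which is used here to characterize
the thinned processes `Φ'` and `Ψ'`. -/
theorem void_ordering_preserved_by_independent_thinning
    {d : ℕ}
    -- the simple point process `Φ`
    {Ω : Type*} [MeasurableSpace Ω] (P : Measure Ω) [IsProbabilityMeasure P]
    (Φ : Ω → Measure (EuclideanSpace ℝ (Fin d)))
    (hΦmeas : Measurable Φ)
    (hΦcount : ∀ᵐ ω ∂P, ∀ B : Set (EuclideanSpace ℝ (Fin d)),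
      MeasurableSet B → Bornology.IsBounded B → ∃ n : ℕ, Φ ω B = n)
    (hΦsimple : ∀ᵐ ω ∂P, ∀ x, Φ ω {x} ≤ 1)
    -- the simple point process `Ψ`
    {Ω' : Type*} [MeasurableSpace Ω'] (P' : Measure Ω') [IsProbabilityMeasure P']
    (Ψ : Ω' → Measure (EuclideanSpace ℝ (Fin d)))
    (hΨmeas : Measurable Ψ)
    (hΨcount : ∀ᵐ ω ∂P', ∀ B : Set (EuclideanSpace ℝ (Fin d)),
      MeasurableSet B → Bornology.IsBounded B → ∃ n : ℕ, Ψ ω B = n)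
    (hΨsimple : ∀ᵐ ω ∂P', ∀ x, Ψ ω {x} ≤ 1)
    -- ordering of void probabilities
    (hvoid : ∀ B : Set (EuclideanSpace ℝ (Fin d)), MeasurableSet B → Bornology.IsBounded B →
      P {ω | Φ ω B = 0} ≤ P' {ω | Ψ ω B = 0})
    -- disjoint bounded Borel sets and retention probabilities
    (k : ℕ) (B : Fin k → Set (EuclideanSpace ℝ (Fin d)))
    (hB : ∀ i, MeasurableSet (B i) ∧ Bornology.IsBounded (B i))
    (hBdisj : Pairwise (Function.onFun Disjoint B))
    (p : Fin k → ℝ) (hp : ∀ i, p i ∈ Set.Icc (0 : ℝ) 1)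
    -- the thinned process `Φ'`, characterized by its void probabilities
    {Ω₁ : Type*} [MeasurableSpace Ω₁] (P₁ : Measure Ω₁) [IsProbabilityMeasure P₁]
    (Φ' : Ω₁ → Measure (EuclideanSpace ℝ (Fin d)))
    (hΦ' : ∀ C : Set (EuclideanSpace ℝ (Fin d)), MeasurableSet C → Bornology.IsBounded C →
      P₁ {ω | Φ' ω C = 0}
        = ∫⁻ ω, ∏ i, (ENNReal.ofReal (1 - p i)) ^ (Φ ω (C ∩ B i)).toReal ∂P)
    -- the thinned process `Ψ'`, characterized by its void probabilities
    {Ω₂ : Type*} [MeasurableSpace Ω₂] (P₂ : Measure Ω₂) [IsProbabilityMeasure P₂]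
    (Ψ' : Ω₂ → Measure (EuclideanSpace ℝ (Fin d)))
    (hΨ' : ∀ C : Set (EuclideanSpace ℝ (Fin d)), MeasurableSet C → Bornology.IsBounded C →
      P₂ {ω | Ψ' ω C = 0}
        = ∫⁻ ω, ∏ i, (ENNReal.ofReal (1 - p i)) ^ (Ψ ω (C ∩ B i)).toReal ∂P') :
    -- conclusion: ordering of void probabilities of the thinned processes
    ∀ C : Set (EuclideanSpace ℝ (Fin d)), MeasurableSet C → Bornology.IsBounded C →
      P₁ {ω | Φ' ω C = 0} ≤ P₂ {ω | Ψ' ω C = 0} := by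
  intro C hC hCb
  rw [hΦ' C hC hCb, hΨ' C hC hCb]
  have hA (i : Fin k) : MeasurableSet (C ∩ B i) := hC.inter (hB i).1
  have hq (i : Fin k) : ENNReal.ofReal (1 - p i) ≤ 1 := by
    simpa using (hp i).1
  have hpq (i : Fin k) : ENNReal.ofReal (p i) + ENNReal.ofReal (1 - p i) = 1 := by
    rw [← ENNReal.ofReal_add (hp i).1 (sub_nonneg.2 (hp i).2)]
    simp
  have hbdd (i : Fin k) (D : Set (EuclideanSpace ℝ (Fin d))) :
      Bornology.IsBounded (D ∩ (C ∩ B i)) :=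
    hCb.subset (Set.inter_subset_right.trans Set.inter_subset_left)
  have hΦlim := tendsto_lintegral_prod_countablePartition P hΦmeas hA
    (hΦcount.mono fun ω h i D hD ↦ h _ (hD.inter (hA i)) (hbdd i D)) hΦsimple hq
  have hΨlim := tendsto_lintegral_prod_countablePartition P' hΨmeas hA
    (hΨcount.mono fun ω h i D hD ↦ h _ (hD.inter (hA i)) (hbdd i D)) hΨsimple hq
  refine le_of_tendsto_of_tendsto' hΦlim hΨlim fun n ↦ ?_
  have hcell : ∀ j ∈ (Finset.univ : Finset (Fin k)) ×ˢ
      (MeasurableSpace.finite_countablePartition (EuclideanSpace ℝ (Fin d)) n).toFinset,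
      MeasurableSet (j.2 ∩ (C ∩ B j.1)) := fun j hj ↦
    (MeasurableSpace.measurableSet_countablePartition n (by simpa using hj)).inter (hA j.1)
  exact lintegral_prod_ite_le P hΦmeas P' hΨmeas _ hcell
    (fun T hT ↦ hvoid _ (T.measurableSet_biUnion fun j hj ↦ hcell j (hT hj))
      ((Bornology.isBounded_biUnion_finset T).2 fun j _ ↦ hbdd j.1 j.2))
    (p := fun j ↦ ENNReal.ofReal (p j.1)) fun j ↦ hpq j.1
end
end

section
/- Let Φ be a simple, stationary point process on ℝ^d of intensity λ that is ν-weakly sub-Poisson, and let ℓ: ℝ^d × ℝ^d → [0,∞) be a measurable response function with shot-noise field V_Φ(y) = Σ_{X∈Φ} ℓ(X,y). Then for any y_1,…,y_m ∈ ℝ^d and any s, h > 0: P(V_Φ(y_i) ≤ h for all 1 ≤ i ≤ m) ≤ e^{smh} · exp( λ ∫_{ℝ^d} ( e^{−s Σ_{i=1}^m ℓ(x,y_i)} − 1 ) dx ). -/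
open MeasureTheory ENNReal Metric

noncomputable section

/-- Extended negative exponential `e^{-x}` on `ℝ≥0∞` (with `e^{-∞} = 0`). -/
def nexpE (x : ℝ≥0∞) : ℝ≥0∞ := if x = ∞ then 0 else ENNReal.ofReal (Real.exp (-x.toReal))

open Filter Topology

theorem nexpE_eq_exp_neg (x : ℝ≥0∞) : nexpE x = EReal.exp (-(x : EReal)) := by
  unfold nexpE
  induction x with
  | top => simp
  | coe x =>
    have : (-((x : ℝ≥0∞) : EReal)) = ((-(x : ℝ) : ℝ) : EReal) := by simp; rfl
    rw [this, EReal.exp_coe]; simp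

theorem continuous_nexpE : Continuous nexpE := by
  rw [show nexpE = _ from funext nexpE_eq_exp_neg]
  have := ENNReal.continuous_exp
  exact this.comp (continuous_neg.comp continuous_coe_ennreal_ereal)

theorem antitone_nexpE : Antitone nexpE := by
  intro x y h
  rw [nexpE_eq_exp_neg, nexpE_eq_exp_neg, EReal.exp_le_exp_iff, EReal.neg_le_neg_iff]
  exact_mod_cast h

theorem nexpE_ofReal {x : ℝ} (hx : 0 ≤ x) :
    nexpE (ENNReal.ofReal x) = ENNReal.ofReal (Real.exp (-x)) := by
  simp [nexpE, ENNReal.toReal_ofReal hx]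

theorem nexpE_zero : nexpE 0 = 1 := by simp [nexpE]

theorem nexpE_le_one (x : ℝ≥0∞) : nexpE x ≤ 1 := nexpE_zero ▸ antitone_nexpE zero_le

theorem nexpE_add (x y : ℝ≥0∞) : nexpE (x + y) = nexpE x * nexpE y := by
  induction x with
  | top => simp [nexpE]
  | coe x =>
    induction y with
    | top => simp [nexpE]
    | coe y =>
      simp only [← ENNReal.ofReal_coe_nnreal]
      rw [← ENNReal.ofReal_add (by positivity) (by positivity), nexpE_ofReal (by positivity),
        nexpE_ofReal (by positivity), nexpE_ofReal (by positivity),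
        ← ENNReal.ofReal_mul (by positivity), ← Real.exp_add, neg_add]

theorem nexpE_sum {ι : Type*} (s : Finset ι) (f : ι → ℝ≥0∞) :
    nexpE (∑ i ∈ s, f i) = ∏ i ∈ s, nexpE (f i) := by
  classical
  induction s using Finset.induction_on with
  | empty => simp [nexpE_zero]
  | insert a s ha ih => rw [Finset.sum_insert ha, Finset.prod_insert ha, nexpE_add, ih]

/-- A Poisson cell of small intensity `x` retained with probability `1 - q`. -/
theorem nexpE_mix_le {q x : ℝ≥0∞} {ε : ℝ} (hq : q ≤ 1) (hε : 0 ≤ ε) (hx : x ≤ ENNReal.ofReal ε) :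
    q + (1 - q) * nexpE x ≤ nexpE ((1 - q) * x * ENNReal.ofReal (1 + ε)⁻¹) := by
  lift q to NNReal using (hq.trans_lt one_lt_top).ne
  lift x to NNReal using (hx.trans_lt ofReal_lt_top).ne
  have hq' : (q : ℝ) ≤ 1 := by exact_mod_cast hq
  have hx' : (x : ℝ) ≤ ε := by
    rw [← ENNReal.ofReal_coe_nnreal, ENNReal.ofReal_le_ofReal_iff hε] at hx; exact hx
  have hp : (0 : ℝ) ≤ 1 - q := by linarith
  have hx0 : (0 : ℝ) ≤ x := x.2
  simp only [← ENNReal.ofReal_coe_nnreal, ← ENNReal.ofReal_one]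
  rw [← ENNReal.ofReal_sub _ (by positivity), ← ENNReal.ofReal_mul hp,
    ← ENNReal.ofReal_mul (by positivity), nexpE_ofReal (by positivity),
    nexpE_ofReal (by positivity),
    ← ENNReal.ofReal_mul hp, ← ENNReal.ofReal_add (by positivity) (by positivity)]
  apply ENNReal.ofReal_le_ofReal
  have h1 : Real.exp (-(x : ℝ)) ≤ (1 + x : ℝ)⁻¹ := by
    rw [Real.exp_neg]
    exact inv_anti₀ (by positivity) (by linarith [Real.add_one_le_exp (x : ℝ)])
  have h2 : (1 + x : ℝ)⁻¹ = 1 - x * (1 + x : ℝ)⁻¹ := by field_simp; ring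
  have h3 : (x : ℝ) * (1 + ε)⁻¹ ≤ x * (1 + x : ℝ)⁻¹ := by gcongr
  have h4 : Real.exp (-(x : ℝ)) ≤ 1 - x * (1 + ε)⁻¹ := by linarith
  have h5 := Real.add_one_le_exp (-((1 - (q:ℝ)) * x * (1 + ε)⁻¹))
  nlinarith [mul_le_mul_of_nonneg_left h4 hp]

section
variable {E Ω : Type*} [MeasurableSpace E] [MeasurableSpace Ω]

theorem nexpE_mul_le {c n : ℝ≥0∞} (h : n = 0 ∨ 1 ≤ n) :
    nexpE (c * n) ≤ nexpE c + (1 - nexpE c) * (if n = 0 then 1 else 0) := by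
  rcases h with rfl | h
  · simp [nexpE_zero, add_tsub_cancel_of_le (nexpE_le_one c)]
  · have : n ≠ 0 := (one_pos.trans_le h).ne'
    simpa [this] using antitone_nexpE (le_mul_of_one_le_right zero_le h)

/-- Disjoint cells `A i`, weighted by `q i` when occupied and by `q i + p i` when void:
the mean product is dominated by its Poisson counterpart. -/
theorem lintegral_prod_void_le {ι : Type*} {P : Measure Ω} {Φ : Ω → Measure E}
    (hΦ : Measurable Φ) {ν : Measure E} {J : Finset ι} {A : ι → Set E}
    (hA : ∀ i, MeasurableSet (A i)) (hdisj : Pairwise (Function.onFun Disjoint A))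
    (hvoid : ∀ S ⊆ J, P {ω | Φ ω (⋃ i ∈ S, A i) = 0} ≤ nexpE (ν (⋃ i ∈ S, A i)))
    (q p : ι → ℝ≥0∞) :
    ∫⁻ ω, ∏ i ∈ J, (q i + p i * (if Φ ω (A i) = 0 then 1 else 0)) ∂P
      ≤ ∏ i ∈ J, (q i + p i * nexpE (ν (A i))) := by
  classical
  have hmeas : ∀ B : Set E, MeasurableSet B → MeasurableSet {ω | Φ ω B = 0} := fun B hB =>
    (Measure.measurable_coe hB).comp hΦ (measurableSet_singleton 0)
  have hprod : ∀ (S : Finset ι) ω, ∏ i ∈ S, (if Φ ω (A i) = 0 then (1 : ℝ≥0∞) else 0) =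
      {ω | Φ ω (⋃ i ∈ S, A i) = 0}.indicator 1 ω := by
    intro S ω
    have : Φ ω (⋃ i ∈ S, A i) = 0 ↔ ∀ i ∈ S, Φ ω (A i) = 0 :=
      measure_biUnion_null_iff S.countable_toSet
    simp only [Set.indicator_apply, Set.mem_ofPred_eq, Pi.one_apply, Finset.prod_ite_zero,
      Finset.prod_const_one, this]
  have hunion : ∀ S : Finset ι, MeasurableSet (⋃ i ∈ S, A i) := fun S =>
    S.measurableSet_biUnion fun i _ => hA i
  simp only [add_comm (q _), Finset.prod_add, Finset.prod_mul_distrib, hprod]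
  rw [lintegral_finsetSum' _ (fun S _ => by
    have := measurable_one.indicator (f := (1 : Ω → ℝ≥0∞)) (hmeas _ (hunion S))
    fun_prop)]
  refine Finset.sum_le_sum fun S hS => ?_
  rw [lintegral_mul_const _ ((measurable_one.indicator (hmeas _ (hunion S))).const_mul _),
    lintegral_const_mul _ (measurable_one.indicator (hmeas _ (hunion S))),
    lintegral_indicator_one (hmeas _ (hunion S)), ← nexpE_sum,
    ← measure_biUnion_finset (fun i _ j _ hij => hdisj hij) (fun i _ => hA i)]
  gcongr
  exact hvoid S (Finset.mem_powerset.1 hS)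
end

/-- A compact set splits into finitely many measurable cells of small diffuse measure. -/
theorem exists_measurable_small_fibers {E : Type*} [TopologicalSpace E] [MeasurableSpace E]
    [BorelSpace E] {ν : Measure E} [ν.OuterRegular] [NullSingletonClass ν] {K : Set E} (hK : IsCompact K)
    {ε : ℝ≥0∞} (hε : 0 < ε) :
    ∃ (n : ℕ) (g : E → Fin n → Prop), Measurable g ∧ ∀ c, ν (g ⁻¹' {c} ∩ K) ≤ ε := by
  have : ∀ x : E, ∃ U, U ⊇ {x} ∧ IsOpen U ∧ ν U < ε := fun x =>
    Set.exists_isOpen_lt_of_lt _ _ (by simpa using hε)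
  choose U hxU hU hνU using this
  obtain ⟨t, ht⟩ := hK.elim_finite_subcover U hU
    (fun x _ => Set.mem_iUnion.2 ⟨x, hxU x rfl⟩)
  refine ⟨t.card, fun x i => x ∈ U (t.equivFin.symm i), ?_, fun c => ?_⟩
  · exact measurable_pi_lambda _ fun i => measurable_mem.2 (hU _).measurableSet
  · by_cases hc : ∃ i, c i
    · obtain ⟨i, hi⟩ := hc
      refine (measure_mono ?_).trans (hνU (t.equivFin.symm i)).le
      rintro x ⟨hx, -⟩
      have := congrFun (Set.mem_singleton_iff.1 hx) i
      simpa [this] using hi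
    · have : (fun x i => x ∈ U (t.equivFin.symm i)) ⁻¹' {c} ∩ K = ∅ := by
        rw [Set.eq_empty_iff_forall_notMem]
        rintro x ⟨hx, hxK⟩
        obtain ⟨z, hz, hxz⟩ := Set.mem_iUnion₂.1 (ht hxK)
        refine hc ⟨t.equivFin ⟨z, hz⟩, ?_⟩
        rw [← Set.mem_singleton_iff.1 hx]
        simpa using hxz
      simp [this]

section
variable {E Ω : Type*} [MetricSpace E] [MeasurableSpace E] [BorelSpace E]
  [MeasurableSpace Ω] {P : Measure Ω} {Φ : Ω → Measure E} {ν : Measure E}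

/-- Laplace functional bound for a simple function restricted to a compact set. -/
theorem lintegral_nexpE_simpleFunc_le [ν.OuterRegular] [NullSingletonClass ν]
    (hΦ : Measurable Φ)
    (hcount : ∀ᵐ ω ∂P, ∀ B, MeasurableSet B → Bornology.IsBounded B → Φ ω B = 0 ∨ 1 ≤ Φ ω B)
    (hvoid : ∀ B, MeasurableSet B → Bornology.IsBounded B →
      P {ω | Φ ω B = 0} ≤ nexpE (ν B))
    (f : SimpleFunc E ℝ≥0∞) {K : Set E} (hK : IsCompact K) :
    ∫⁻ ω, nexpE (∫⁻ x in K, f x ∂Φ ω) ∂P ≤ nexpE (∫⁻ x in K, (1 - nexpE (f x)) ∂ν) := by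
  have key : ∀ ε : ℝ, 0 < ε → ∫⁻ ω, nexpE (∫⁻ x in K, f x ∂Φ ω) ∂P ≤
      nexpE ((∫⁻ x in K, (1 - nexpE (f x)) ∂ν) * ENNReal.ofReal (1 + ε)⁻¹) := by
    intro ε hε
    obtain ⟨n, g, hg, hgK⟩ := exists_measurable_small_fibers (ν := ν) hK (ENNReal.ofReal_pos.2 hε)
    let ψ : SimpleFunc E (ℝ≥0∞ × (Fin n → Prop)) :=
      f.pair ⟨g, fun c => hg (measurableSet_singleton c), Set.toFinite _⟩
    let A : ℝ≥0∞ × (Fin n → Prop) → Set E := fun c => ψ ⁻¹' {c} ∩ K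
    have hA : ∀ c, MeasurableSet (A c) := fun c =>
      (ψ.measurableSet_fiber c).inter hK.measurableSet
    have hAK : ∀ c, A c ⊆ K := fun c => Set.inter_subset_right
    have hint : ∀ (u : ℝ≥0∞ → ℝ≥0∞) (μ : Measure E),
        ∫⁻ x in K, u (f x) ∂μ = ∑ c ∈ ψ.range, u c.1 * μ (A c) := by
      intro u μ
      have h := SimpleFunc.lintegral_eq_lintegral (ψ.map (u ∘ Prod.fst)) (μ.restrict K)
      rw [SimpleFunc.map_lintegral] at h
      refine Eq.trans ?_ (h.trans (Finset.sum_congr rfl fun c _ => ?_))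
      · rfl
      · rw [Measure.restrict_apply (ψ.measurableSet_fiber c)]; rfl
    have hdisj : Pairwise (Function.onFun Disjoint A) := by
      intro c c' hcc
      exact ((Set.disjoint_singleton.2 hcc).preimage ψ).mono Set.inter_subset_left
        Set.inter_subset_left
    have hsmall : ∀ c, ν (A c) ≤ ENNReal.ofReal ε := by
      intro c
      refine (measure_mono ?_).trans (hgK c.2)
      rintro x ⟨hx, hxK⟩
      exact ⟨congrArg Prod.snd hx, hxK⟩
    calc ∫⁻ ω, nexpE (∫⁻ x in K, f x ∂Φ ω) ∂P
        ≤ ∫⁻ ω, ∏ c ∈ ψ.range,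
            (nexpE c.1 + (1 - nexpE c.1) * (if Φ ω (A c) = 0 then 1 else 0)) ∂P := by
          refine lintegral_mono_ae ?_
          filter_upwards [hcount] with ω hω
          rw [hint (fun c => c), nexpE_sum]
          exact Finset.prod_le_prod' fun c _ =>
            nexpE_mul_le (hω _ (hA c) (hK.isBounded.subset (hAK c)))
      _ ≤ ∏ c ∈ ψ.range, (nexpE c.1 + (1 - nexpE c.1) * nexpE (ν (A c))) := by
          refine lintegral_prod_void_le hΦ hA hdisj (fun S _ => hvoid _ ?_ ?_) _ _
          · exact S.measurableSet_biUnion fun c _ => hA c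
          · exact hK.isBounded.subset (Set.iUnion₂_subset fun c _ => hAK c)
      _ ≤ ∏ c ∈ ψ.range, nexpE ((1 - nexpE c.1) * ν (A c) * ENNReal.ofReal (1 + ε)⁻¹) :=
          Finset.prod_le_prod' fun c _ => nexpE_mix_le (nexpE_le_one _) hε.le (hsmall c)
      _ = _ := by rw [← nexpE_sum, ← Finset.sum_mul, ← hint (fun c => 1 - nexpE c)]
  set T := ∫⁻ x in K, (1 - nexpE (f x)) ∂ν
  have hlim : Tendsto (fun ε : ℝ => nexpE (T * ENNReal.ofReal (1 + ε)⁻¹)) (𝓝[>] 0)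
      (𝓝 (nexpE T)) := by
    refine (continuous_nexpE.tendsto T).comp ?_
    have h1 : Tendsto (fun ε : ℝ => (1 + ε)⁻¹) (𝓝[>] 0) (𝓝 1) := by
      have : ContinuousAt (fun ε : ℝ => (1 + ε)⁻¹) 0 := by fun_prop (disch := norm_num)
      simpa using this.tendsto.mono_left nhdsWithin_le_nhds
    simpa using ENNReal.Tendsto.const_mul (a := T) (ENNReal.tendsto_ofReal h1)
      (Or.inl (by simp))
  exact ge_of_tendsto hlim (eventually_mem_nhdsWithin.mono key)

/-- Laplace functional bound for a counting process whose void probabilities are dominated by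
those of a Poisson process with diffuse intensity measure `ν`. -/
theorem lintegral_nexpE_lintegral_le [ProperSpace E] [ν.OuterRegular] [NullSingletonClass ν]
    (hΦ : Measurable Φ)
    (hcount : ∀ᵐ ω ∂P, ∀ B, MeasurableSet B → Bornology.IsBounded B → Φ ω B = 0 ∨ 1 ≤ Φ ω B)
    (hvoid : ∀ B, MeasurableSet B → Bornology.IsBounded B →
      P {ω | Φ ω B = 0} ≤ nexpE (ν B))
    {f : E → ℝ≥0∞} (hf : Measurable f) :
    ∫⁻ ω, nexpE (∫⁻ x, f x ∂Φ ω) ∂P ≤ nexpE (∫⁻ x, (1 - nexpE (f x)) ∂ν) := by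
  let K := compactCovering E
  have hK : ∀ n, IsCompact (K n) := isCompact_compactCovering E
  have hfn : ∀ n, Measurable fun x => 1 - nexpE (SimpleFunc.eapprox f n x) := fun n =>
    measurable_const.sub (continuous_nexpE.measurable.comp (SimpleFunc.measurable _))
  have hmono : ∀ x, Monotone fun n => 1 - nexpE (SimpleFunc.eapprox f n x) := fun x i j hij =>
    tsub_le_tsub_left (antitone_nexpE (SimpleFunc.monotone_eapprox f hij x)) _
  have hlim : Tendsto (fun n => ∫⁻ x in K n, (1 - nexpE (SimpleFunc.eapprox f n x)) ∂ν) atTop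
      (𝓝 (∫⁻ x, (1 - nexpE (f x)) ∂ν)) := by
    simp only [← lintegral_indicator (hK _).measurableSet]
    refine lintegral_tendsto_of_tendsto_of_monotone
      (fun n => ((hfn n).indicator (hK n).measurableSet).aemeasurable)
      (ae_of_all _ fun x i j hij => ?_) (ae_of_all _ fun x => ?_)
    · exact (Set.indicator_le_indicator_of_subset (compactCovering_subset E hij)
        (fun _ => zero_le) x).trans (Set.indicator_le_indicator (hmono x hij))
    · obtain ⟨n, hn⟩ := Set.mem_iUnion.1 (iUnion_compactCovering E ▸ Set.mem_univ x)
      have h1 := ENNReal.Tendsto.sub (tendsto_const_nhds (x := (1 : ℝ≥0∞)))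
        ((continuous_nexpE.tendsto _).comp (SimpleFunc.tendsto_eapprox hf x))
        (Or.inl one_ne_top)
      refine h1.congr' ?_
      filter_upwards [eventually_ge_atTop n] with k hk
      rw [Set.indicator_of_mem (compactCovering_subset E hk hn)]
      rfl
  refine ge_of_tendsto' ((continuous_nexpE.tendsto _).comp hlim) fun n => ?_
  refine le_trans (lintegral_mono fun ω => antitone_nexpE ?_)
    (lintegral_nexpE_simpleFunc_le hΦ hcount hvoid (SimpleFunc.eapprox f n) (hK n))
  refine (setLIntegral_le_lintegral _ _).trans (lintegral_mono fun x => ?_)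
  exact (le_iSup (fun n => SimpleFunc.eapprox f n x) n).trans_eq
    (SimpleFunc.iSup_eapprox_apply hf x)
end

theorem le_nexpE_of_add_eq_one {a t : ℝ≥0∞} (h : a + t = 1) : a ≤ nexpE t := by
  have ht : t ≤ 1 := h ▸ le_add_self
  have ha : a ≤ 1 := h ▸ le_self_add
  lift t to NNReal using (ht.trans_lt one_lt_top).ne
  lift a to NNReal using (ha.trans_lt one_lt_top).ne
  have h' : (a : ℝ) + t = 1 := by exact_mod_cast h
  simp only [← ENNReal.ofReal_coe_nnreal]
  rw [nexpE_ofReal t.coe_nonneg]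
  exact ENNReal.ofReal_le_ofReal (by linarith [Real.add_one_le_exp (-(t : ℝ))])

/-- Laplace functional bound on a one-point space, where the intensity measure is an atom. -/
theorem lintegral_nexpE_lintegral_le_of_unique {E Ω : Type*} [Unique E] [MeasurableSpace E]
    [MeasurableSpace Ω] {P : Measure Ω} [IsProbabilityMeasure P] {Φ : Ω → Measure E}
    {ν : Measure E} (hΦ : Measurable Φ)
    (hcount : ∀ᵐ ω ∂P, Φ ω Set.univ = 0 ∨ Φ ω Set.univ = 1)
    (hint : ∫⁻ ω, Φ ω Set.univ ∂P = ν Set.univ) (f : E → ℝ≥0∞) :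
    ∫⁻ ω, nexpE (∫⁻ x, f x ∂Φ ω) ∂P ≤ nexpE (∫⁻ x, (1 - nexpE (f x)) ∂ν) := by
  have hN : Measurable fun ω => Φ ω Set.univ :=
    (Measure.measurable_coe MeasurableSet.univ).comp hΦ
  simp only [lintegral_unique]
  apply le_nexpE_of_add_eq_one
  rw [← hint, ← lintegral_const_mul _ hN, ← lintegral_add_right _ (hN.const_mul _)]
  refine (lintegral_congr_ae (g := 1) ?_).trans (by simp)
  filter_upwards [hcount] with ω hω
  rcases hω with h | h <;> simp [h, nexpE_zero, add_tsub_cancel_of_le (nexpE_le_one _)]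

/-- Chernoff-type upper bound on the lower level-crossing probabilities
of the shot-noise field of a simple, stationary, ν-weakly sub-Poisson point process
of intensity `λ`. -/
theorem lower_level_bound_shotNoise_of_nuWeaklySubPoisson
    {d : ℕ} {Ω : Type*} [MeasurableSpace Ω] (P : Measure Ω) [IsProbabilityMeasure P]
    (Φ : Ω → Measure (EuclideanSpace ℝ (Fin d)))
    (hΦmeas : Measurable Φ)
    -- `Φ` is a point process: almost surely a Radon counting measure
    (hcount : ∀ᵐ ω ∂P, ∀ B : Set (EuclideanSpace ℝ (Fin d)),
      MeasurableSet B → Bornology.IsBounded B → ∃ n : ℕ, Φ ω B = n)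
    -- `Φ` is simple
    (hsimple : ∀ᵐ ω ∂P, ∀ x, Φ ω {x} ≤ 1)
    -- `Φ` is stationary with intensity `lam`
    (lam : ℝ) (hlam : 0 < lam)
    (hstat : ∀ v : EuclideanSpace ℝ (Fin d),
      P.map (fun ω => (Φ ω).map (fun x => v + x)) = P.map Φ)
    (hint : ∀ B : Set (EuclideanSpace ℝ (Fin d)), MeasurableSet B →
      ∫⁻ ω, Φ ω B ∂P = ENNReal.ofReal lam * volume B)
    -- `Φ` is ν-weakly sub-Poisson
    (hnu : ∀ B : Set (EuclideanSpace ℝ (Fin d)), MeasurableSet B → Bornology.IsBounded B →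
      P {ω | Φ ω B = 0} ≤ ENNReal.ofReal (Real.exp (-(∫⁻ ω, Φ ω B ∂P).toReal)))
    -- measurable nonnegative response function
    (ℓ : EuclideanSpace ℝ (Fin d) → EuclideanSpace ℝ (Fin d) → ℝ)
    (hℓmeas : Measurable (Function.uncurry ℓ))
    (hℓ0 : ∀ x y, 0 ≤ ℓ x y)
    (m : ℕ) (y : Fin m → EuclideanSpace ℝ (Fin d)) (s h : ℝ) (hs : 0 < s) (hh : 0 < h) :
    P {ω | ∀ i, shotNoise (Φ ω) ℓ (y i) ≤ ENNReal.ofReal h}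
      ≤ ENNReal.ofReal (Real.exp (s * m * h)) *
        nexpE (ENNReal.ofReal lam *
          ∫⁻ x : EuclideanSpace ℝ (Fin d),
            ENNReal.ofReal (1 - Real.exp (-(s * ∑ i, ℓ x (y i))))) := by
  let ν : Measure (EuclideanSpace ℝ (Fin d)) := lam.toNNReal • volume
  have hν : ∀ B, ν B = ENNReal.ofReal lam * volume B := fun B => rfl
  let F : EuclideanSpace ℝ (Fin d) → ℝ≥0∞ := fun x =>
    ∑ i, ENNReal.ofReal s * ENNReal.ofReal (ℓ x (y i))
  have hℓi : ∀ i, Measurable fun x => ENNReal.ofReal (ℓ x (y i)) := fun i =>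
    (hℓmeas.comp (measurable_id.prodMk measurable_const)).ennreal_ofReal
  have hF : Measurable F := Finset.measurable_fun_sum _ fun i _ => (hℓi i).const_mul _
  have hFreal : ∀ x, 1 - nexpE (F x) =
      ENNReal.ofReal (1 - Real.exp (-(s * ∑ i, ℓ x (y i)))) := by
    intro x
    have h0 : 0 ≤ ∑ i, ℓ x (y i) := Finset.sum_nonneg fun i _ => hℓ0 x (y i)
    have : F x = ENNReal.ofReal (s * ∑ i, ℓ x (y i)) := by
      rw [ENNReal.ofReal_mul hs.le, ENNReal.ofReal_sum_of_nonneg fun i _ => hℓ0 x (y i),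
        Finset.mul_sum]
    rw [this, nexpE_ofReal (by positivity), ENNReal.ofReal_sub _ (Real.exp_pos _).le,
      ENNReal.ofReal_one]
  have hlaplace : ∫⁻ ω, nexpE (∫⁻ x, F x ∂Φ ω) ∂P ≤ nexpE (∫⁻ x, (1 - nexpE (F x)) ∂ν) := by
    rcases Nat.eq_zero_or_pos d with rfl | hd
    · refine lintegral_nexpE_lintegral_le_of_unique hΦmeas ?_ (hint _ MeasurableSet.univ) F
      filter_upwards [hcount, hsimple] with ω h1 h2
      obtain ⟨n, hn⟩ := h1 _ MeasurableSet.univ (Set.subsingleton_univ.finite.isBounded)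
      have h3 := h2 default
      rw [← Set.eq_univ_of_forall (s := {default}) fun x => Subsingleton.elim x default] at hn
      rw [hn] at h3
      have h4 : n ≤ 1 := by exact_mod_cast h3
      rw [← Set.eq_univ_of_forall (s := {default}) fun x => Subsingleton.elim x default, hn]
      interval_cases n <;> simp
    · have : Nonempty (Fin d) := ⟨⟨0, hd⟩⟩
      have : NullSingletonClass ν := ⟨fun x => by simp [hν]⟩
      refine lintegral_nexpE_lintegral_le hΦmeas ?_ (fun B hB hb => ?_) hF
      · filter_upwards [hcount] with ω h1 B hB hb
        obtain ⟨n, hn⟩ := h1 B hB hb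
        rw [hn]
        rcases n.eq_zero_or_pos with rfl | h
        · simp
        · exact Or.inr (by exact_mod_cast h)
      · refine (hnu B hB hb).trans_eq ?_
        rw [hint B hB, ← hν, nexpE, if_neg]
        rw [hν]
        exact ENNReal.mul_ne_top ofReal_ne_top hb.measure_lt_top.ne
  have hνint : ∫⁻ x, (1 - nexpE (F x)) ∂ν = ENNReal.ofReal lam *
      ∫⁻ x, ENNReal.ofReal (1 - Real.exp (-(s * ∑ i, ℓ x (y i)))) := by
    simp only [hFreal]
    exact lintegral_smul_measure _ _
  rw [← hνint]
  have hshn : 0 ≤ s * m * h := by positivity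
  have hmarkov := mul_meas_ge_le_lintegral (μ := P)
    (continuous_nexpE.measurable.comp ((Measure.measurable_lintegral hF).comp hΦmeas))
    (nexpE (ENNReal.ofReal (s * m * h)))
  have hsub : {ω | ∀ i, shotNoise (Φ ω) ℓ (y i) ≤ ENNReal.ofReal h} ⊆
      {ω | nexpE (ENNReal.ofReal (s * m * h)) ≤ nexpE (∫⁻ x, F x ∂Φ ω)} := by
    intro ω hω
    refine antitone_nexpE ?_
    calc ∫⁻ x, F x ∂Φ ω = ∑ i, ENNReal.ofReal s * shotNoise (Φ ω) ℓ (y i) := by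
          rw [lintegral_finsetSum _ fun i _ => (hℓi i).const_mul _]
          exact Finset.sum_congr rfl fun i _ => lintegral_const_mul _ (hℓi i)
      _ ≤ ∑ i : Fin m, ENNReal.ofReal s * ENNReal.ofReal h := by
          gcongr with i
          exact hω i
      _ = ENNReal.ofReal (s * m * h) := by
          rw [mul_right_comm, mul_comm _ (m : ℝ), ENNReal.ofReal_mul (by positivity),
            ENNReal.ofReal_mul hs.le]
          simp
  calc P {ω | ∀ i, shotNoise (Φ ω) ℓ (y i) ≤ ENNReal.ofReal h}
      ≤ P {ω | nexpE (ENNReal.ofReal (s * m * h)) ≤ nexpE (∫⁻ x, F x ∂Φ ω)} := measure_mono hsub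
    _ = ENNReal.ofReal (Real.exp (s * m * h)) * (nexpE (ENNReal.ofReal (s * m * h)) *
          P {ω | nexpE (ENNReal.ofReal (s * m * h)) ≤ nexpE (∫⁻ x, F x ∂Φ ω)}) := by
        rw [← mul_assoc, nexpE_ofReal hshn, ← ENNReal.ofReal_mul (Real.exp_pos _).le,
          ← Real.exp_add]
        simp
    _ ≤ _ := by
        gcongr
        exact hmarkov.trans hlaplace
end
end

section
/- For every dimension d ≥ 2 and every intensity λ > 0 there exists a constant c(λ) > 0, depending only on λ and d (and not on the distribution of the point process), such that every simple, stationary, α-weakly sub-Poisson point process Φ on ℝ^d of intensity λ satisfies r_c(Φ) ≥ c(λ); that is, for all radii r < c(λ) the Boolean model C(Φ,r) almost surely does not percolate. -/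
open MeasureTheory ENNReal Metric

noncomputable section

/-- A subset of `ℝ^d` percolates if it contains an unbounded connected subset. -/
def Percolates {d : ℕ} (S : Set (EuclideanSpace ℝ (Fin d))) : Prop :=
  ∃ C : Set (EuclideanSpace ℝ (Fin d)), C ⊆ S ∧ IsConnected C ∧ ¬ Bornology.IsBounded C

/-- The set of atoms (points) of a counting measure. -/
def atomsOf {d : ℕ} (μ : Measure (EuclideanSpace ℝ (Fin d))) :
    Set (EuclideanSpace ℝ (Fin d)) :=
  {x | μ {x} ≠ 0}

/-- The Boolean model `C(Φ,r) = ⋃_{X ∈ Φ} B_r(X)` of a counting measure. -/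
def BooleanModel {d : ℕ} (μ : Measure (EuclideanSpace ℝ (Fin d))) (r : ℝ) :
    Set (EuclideanSpace ℝ (Fin d)) :=
  ⋃ x ∈ atomsOf μ, closedBall x r

/-- The half-open cube of side `s` with index `z` in the lattice partition of `ℝ^d`. -/
def latticeCube {d : ℕ} (s : ℝ) (z : Fin d → ℤ) : Set (EuclideanSpace ℝ (Fin d)) :=
  {x | ∀ i, ⌊x i / s⌋ = z i}

lemma measurableSet_latticeCube {d : ℕ} (s : ℝ) (z : Fin d → ℤ) :
    MeasurableSet (latticeCube s z) := by
  have h : latticeCube s z = ⋂ i, {x : EuclideanSpace ℝ (Fin d) | ⌊x i / s⌋ = z i} := by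
    ext x; simp [latticeCube]
  rw [h]
  refine MeasurableSet.iInter fun i => ?_
  have hm : Measurable fun x : EuclideanSpace ℝ (Fin d) => ⌊x i / s⌋ :=
    Int.measurable_floor.comp (by fun_prop)
  exact hm (measurableSet_singleton (z i))

lemma latticeCube_subset_preimage_pi {d : ℕ} {s : ℝ} (hs : 0 < s) (z : Fin d → ℤ) :
    latticeCube s z ⊆ (WithLp.ofLp : EuclideanSpace ℝ (Fin d) → Fin d → ℝ) ⁻¹'
      Set.univ.pi fun i => Set.Icc (z i * s) ((z i + 1) * s) := by
  intro x hx i _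
  obtain ⟨h1, h2⟩ := Int.floor_eq_iff.1 (hx i)
  exact ⟨(le_div_iff₀ hs).1 h1, ((div_lt_iff₀ hs).1 h2).le⟩

lemma isBounded_latticeCube {d : ℕ} {s : ℝ} (hs : 0 < s) (z : Fin d → ℤ) :
    Bornology.IsBounded (latticeCube s z) := by
  refine Bornology.IsBounded.subset ?_ (latticeCube_subset_preimage_pi hs z)
  refine (PiLp.antilipschitzWith_ofLp 2 (fun _ : Fin d => ℝ)).isBounded_preimage ?_
  exact Bornology.IsBounded.pi fun i => Metric.isBounded_Icc _ _

lemma volume_latticeCube_le {d : ℕ} {s : ℝ} (hs : 0 < s) (z : Fin d → ℤ) :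
    volume (latticeCube s z) ≤ ENNReal.ofReal s ^ d := by
  refine (measure_mono (latticeCube_subset_preimage_pi hs z)).trans ?_
  rw [(PiLp.volume_preserving_ofLp (Fin d)).measure_preimage
    (MeasurableSet.univ_pi fun i => measurableSet_Icc).nullMeasurableSet, volume_pi_pi]
  simp [Real.volume_Icc, add_mul]

lemma disjoint_latticeCube {d : ℕ} (s : ℝ) {z w : Fin d → ℤ} (h : z ≠ w) :
    Disjoint (latticeCube s z) (latticeCube s w) :=
  Set.disjoint_left.2 fun _ hz hw => h (funext fun i => (hz i).symm.trans (hw i))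

lemma abs_floor_div_sub_floor_div_le_one {a b s : ℝ} (hs : 0 < s) (h : |a - b| < s) :
    |⌊a / s⌋ - ⌊b / s⌋| ≤ 1 := by
  have h' : |a / s - b / s| < 1 := by
    rw [← sub_div, abs_div, abs_of_pos hs]
    exact (div_lt_one hs).2 h
  obtain ⟨h1, h2⟩ := abs_lt.1 h'
  have ha := Int.floor_le (a / s)
  have ha' := Int.lt_floor_add_one (a / s)
  have hb := Int.floor_le (b / s)
  have hb' := Int.lt_floor_add_one (b / s)
  have e1 : ⌊a / s⌋ - ⌊b / s⌋ < 2 := by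
    have : ((⌊a / s⌋ - ⌊b / s⌋ : ℤ) : ℝ) < (2 : ℤ) := by push_cast; linarith
    exact_mod_cast this
  have e2 : -2 < ⌊a / s⌋ - ⌊b / s⌋ := by
    have : ((-2 : ℤ) : ℝ) < ((⌊a / s⌋ - ⌊b / s⌋ : ℤ) : ℝ) := by push_cast; linarith
    exact_mod_cast this
  rw [abs_le]
  omega

/-- The graph on `ℤ^d` joining distinct points of `O` at sup-distance one. -/
def siteGraph {d : ℕ} (O : Set (Fin d → ℤ)) : SimpleGraph (Fin d → ℤ) where
  Adj z w := z ≠ w ∧ z ∈ O ∧ w ∈ O ∧ ∀ i, |z i - w i| ≤ 1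
  symm := ⟨fun _ _ h => ⟨h.1.symm, h.2.2.1, h.2.1, fun i =>
    (abs_sub_comm _ _).trans_le (h.2.2.2 i)⟩⟩
  loopless := ⟨fun _ h => h.1 rfl⟩

lemma abs_sub_le_length_siteGraph_walk {d : ℕ} {O : Set (Fin d → ℤ)} {z w : Fin d → ℤ}
    (p : (siteGraph O).Walk z w) (i : Fin d) : |z i - w i| ≤ p.length := by
  induction p with
  | nil => simp
  | cons h p ih =>
    have := abs_le.1 (h.2.2.2 i)
    have := abs_le.1 ih
    rw [abs_le, SimpleGraph.Walk.length_cons]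
    push_cast
    omega

/-- The lattice path with starting point `z` and successive increments `g`. -/
def incrementPath {d n : ℕ} (z : Fin d → ℤ) (g : Fin n → Fin d → ℤ) (i : Fin (n + 1)) :
    Fin d → ℤ :=
  z + Fin.partialSum g i

/-- The finite set of sequences of `n` steps of sup-norm at most one. -/
def latticeSteps (d n : ℕ) : Finset (Fin n → Fin d → ℤ) :=
  Fintype.piFinset fun _ => Fintype.piFinset fun _ => Finset.Icc (-1) 1

lemma card_latticeSteps (d n : ℕ) : (latticeSteps d n).card = (3 ^ d) ^ n := by
  simp [latticeSteps]

/-- A point whose component leaves the box of radius `n` starts a self-avoiding path of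
length `n` inside `O`. -/
lemma exists_incrementPath_of_reachable {d : ℕ} {O : Set (Fin d → ℤ)} {z w : Fin d → ℤ}
    (hz : z ∈ O) (h : (siteGraph O).Reachable z w) {n : ℕ} {k : Fin d}
    (hk : (n : ℤ) < |z k - w k|) :
    ∃ g ∈ latticeSteps d n, Function.Injective (incrementPath z g) ∧
      ∀ i, incrementPath z g i ∈ O := by
  classical
  obtain ⟨p, hp⟩ := h.exists_isPath
  have hn : n < p.length := by
    exact_mod_cast hk.trans_le (abs_sub_le_length_siteGraph_walk p k)
  have hadj (j : ℕ) (hj : j < n) : (siteGraph O).Adj (p.getVert j) (p.getVert (j + 1)) :=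
    p.adj_getVert_succ (hj.trans hn)
  set g : Fin n → Fin d → ℤ := fun j => p.getVert (j + 1) - p.getVert j with hg
  have hpath : ∀ i : Fin (n + 1), incrementPath z g i = p.getVert i := by
    intro i
    induction i using Fin.induction with
    | zero => simp [incrementPath]
    | succ j ih =>
      have : incrementPath z g j.succ = incrementPath z g j.castSucc + g j := by
        simp [incrementPath, Fin.partialSum_succ, add_assoc]
      rw [this, ih, hg]
      simp
  refine ⟨g, ?_, ?_, ?_⟩
  · simp only [latticeSteps, Fintype.mem_piFinset, Finset.mem_Icc]
    intro j i
    have := abs_le.1 ((hadj j j.2).2.2.2 i)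
    simp only [hg, Pi.sub_apply]
    omega
  · intro i j hij
    rw [hpath, hpath] at hij
    have hi : (i : ℕ) ≤ p.length := by omega
    have hj : (j : ℕ) ≤ p.length := by omega
    exact Fin.ext (hp.getVert_injOn hi hj hij)
  · intro i
    rw [hpath]
    induction i using Fin.cases with
    | zero => simpa using hz
    | succ j => exact (hadj j j.2).2.2.1

lemma Percolates.exists_incrementPath {d : ℕ} {μ : Measure (EuclideanSpace ℝ (Fin d))} {s r : ℝ}
    (hs : 0 < s) (hr : r < s / 2) (h : Percolates (BooleanModel μ r)) :
    ∃ z : Fin d → ℤ, ∀ n : ℕ, ∃ g ∈ latticeSteps d n,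
      Function.Injective (incrementPath z g) ∧
        ∀ i, (latticeCube s (incrementPath z g i) ∩ atomsOf μ).Nonempty := by
  obtain ⟨C, hCS, hC, hCb⟩ := h
  set O : Set (Fin d → ℤ) := {z | (latticeCube s z ∩ atomsOf μ).Nonempty}
  let idx (x : EuclideanSpace ℝ (Fin d)) : Fin d → ℤ := fun i => ⌊x i / s⌋
  have hidx (x) (hx : x ∈ atomsOf μ) : idx x ∈ O := ⟨x, fun _ => rfl, hx⟩
  have hcover : ∀ y ∈ C, ∃ x ∈ atomsOf μ, y ∈ ball x (s / 2) := by
    intro y hy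
    have := hCS hy
    simp only [BooleanModel, Set.mem_iUnion] at this
    obtain ⟨x, hx, hxy⟩ := this
    exact ⟨x, hx, closedBall_subset_ball hr hxy⟩
  obtain ⟨y₀, hy₀⟩ := hC.nonempty
  obtain ⟨x₀, hx₀, hxy₀⟩ := hcover y₀ hy₀
  refine ⟨idx x₀, fun n => ?_⟩
  by_contra hno
  set K : Set (Fin d → ℤ) := {w | (siteGraph O).Reachable (idx x₀) w}
  have hKbox : K ⊆ Set.univ.pi fun i => Set.Icc (idx x₀ i - n) (idx x₀ i + n) := by
    intro w hw i _
    by_contra hwi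
    refine hno (exists_incrementPath_of_reachable (hidx x₀ hx₀) hw (k := i) ?_)
    simp only [Set.mem_Icc, not_and_or, not_le] at hwi
    rw [lt_abs]
    omega
  have hKfin : K.Finite := (Set.Finite.pi' fun i => Set.finite_Icc _ _).subset
    fun w hw i => hKbox hw i trivial
  set U := ⋃ x ∈ {x ∈ atomsOf μ | idx x ∈ K}, ball x (s / 2) with hU
  set V := ⋃ x ∈ {x ∈ atomsOf μ | idx x ∉ K}, ball x (s / 2) with hV
  have hUo : IsOpen U := isOpen_biUnion fun _ _ => isOpen_ball
  have hVo : IsOpen V := isOpen_biUnion fun _ _ => isOpen_ball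
  have hUV : Disjoint U V := by
    rw [Set.disjoint_left]
    intro y hyU hyV
    simp only [hU, hV, Set.mem_iUnion, Set.mem_ofPred_eq, exists_prop] at hyU hyV
    obtain ⟨a, ⟨ha, haK⟩, hya⟩ := hyU
    obtain ⟨b, ⟨hb, hbK⟩, hyb⟩ := hyV
    have hab : dist a b < s := by
      have := dist_triangle_left a b y
      rw [mem_ball] at hya hyb
      linarith
    refine hbK (SimpleGraph.Reachable.trans haK (SimpleGraph.Adj.reachable
      ⟨fun e => hbK (e ▸ haK), hidx a ha, hidx b hb, fun i => ?_⟩))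
    refine abs_floor_div_sub_floor_div_le_one hs (lt_of_le_of_lt ?_ hab)
    have := PiLp.norm_apply_le (a - b) i
    rwa [← dist_eq_norm] at this
  have hCUV : C ⊆ U ∪ V := by
    intro y hy
    obtain ⟨x, hx, hxy⟩ := hcover y hy
    by_cases hxK : idx x ∈ K
    · exact Or.inl (Set.mem_biUnion (show x ∈ {x ∈ atomsOf μ | idx x ∈ K} from ⟨hx, hxK⟩) hxy)
    · exact Or.inr (Set.mem_biUnion (show x ∈ {x ∈ atomsOf μ | idx x ∉ K} from ⟨hx, hxK⟩) hxy)
  have hCU : C ⊆ U := hC.isPreconnected.subset_left_of_subset_union hUo hVo hUV hCUV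
    ⟨y₀, hy₀, Set.mem_biUnion (show x₀ ∈ {x ∈ atomsOf μ | idx x ∈ K} from
      ⟨hx₀, SimpleGraph.Reachable.refl _⟩) hxy₀⟩
  refine hCb (Bornology.IsBounded.subset
    ((Bornology.isBounded_biUnion hKfin).2 fun z _ =>
      (isBounded_latticeCube hs z).thickening (δ := s / 2)) (hCU.trans ?_))
  refine Set.iUnion₂_subset fun x hx y hy => ?_
  exact Set.mem_biUnion hx.2 (mem_thickening_iff.2 ⟨x, fun _ => rfl, hy⟩)

/-- Markov's inequality for the simultaneous occupation of disjoint sets. -/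
lemma measure_forall_one_le_le {d k : ℕ} {Ω : Type*} [MeasurableSpace Ω] {P : Measure Ω}
    {Φ : Ω → Measure (EuclideanSpace ℝ (Fin d))} {B : Fin k → Set (EuclideanSpace ℝ (Fin d))}
    (hΦ : Measurable Φ) (hB : ∀ i, MeasurableSet (B i))
    (hsub : ∫⁻ ω, ∏ i, Φ ω (B i) ∂P ≤ ∏ i, ∫⁻ ω, Φ ω (B i) ∂P) {ε : ℝ≥0∞}
    (hε : ∀ i, ∫⁻ ω, Φ ω (B i) ∂P ≤ ε) :
    P {ω | ∀ i, 1 ≤ Φ ω (B i)} ≤ ε ^ k := by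
  have hm : Measurable fun ω => ∏ i, Φ ω (B i) :=
    Finset.measurable_fun_prod _ fun i _ => (Measure.measurable_coe (hB i)).comp hΦ
  calc P {ω | ∀ i, 1 ≤ Φ ω (B i)}
      ≤ P {ω | 1 ≤ ∏ i, Φ ω (B i)} :=
        measure_mono fun ω hω => Finset.one_le_prod' fun i _ => hω i
    _ ≤ ∫⁻ ω, ∏ i, Φ ω (B i) ∂P := by
        simpa using mul_meas_ge_le_lintegral (μ := P) hm 1
    _ ≤ ∏ i, ∫⁻ ω, Φ ω (B i) ∂P := hsub
    _ ≤ ∏ _i : Fin k, ε := Finset.prod_le_prod' fun i _ => hε i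
    _ = ε ^ k := by simp

lemma exists_side_length {d : ℕ} (hd : d ≠ 0) (lam : ℝ) :
    ∃ s : ℝ, 0 < s ∧ ENNReal.ofReal lam * ENNReal.ofReal s ^ d * 3 ^ d < 1 := by
  have hc : Continuous fun s : ℝ => lam * s ^ d * 3 ^ d := by fun_prop
  have h := (hc.tendsto 0).eventually_lt_const
    (show lam * (0 : ℝ) ^ d * 3 ^ d < 1 by simp [hd])
  obtain ⟨s, hs1, hs⟩ :=
    ((h.filter_mono nhdsWithin_le_nhds).and (self_mem_nhdsWithin (s := Set.Ioi (0 : ℝ)))).exists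
  refine ⟨s, hs, ?_⟩
  have hs' : (0 : ℝ) ≤ s := le_of_lt hs
  have e : ENNReal.ofReal lam * ENNReal.ofReal s ^ d * 3 ^ d
      = ENNReal.ofReal (lam * s ^ d * 3 ^ d) := by
    rw [ENNReal.ofReal_mul' (by positivity), ENNReal.ofReal_mul' (by positivity),
      ENNReal.ofReal_pow hs', ENNReal.ofReal_pow (by norm_num)]
    norm_num
  rw [e]
  exact ENNReal.ofReal_lt_one.2 hs1

/-- for every dimension `d ≥ 2` and intensity `λ > 0` there is a constant
`c(λ) > 0`, not depending on the distribution of the point process, such that for every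
simple, stationary, α-weakly sub-Poisson point process `Φ` of intensity `λ` and every
radius `r < c(λ)`, the Boolean model `C(Φ,r)` almost surely does not percolate
(equivalently, `r_c(Φ) ≥ c(λ)`). -/
theorem critical_radius_lower_bound_of_alphaWeaklySubPoisson :
    ∀ d : ℕ, 2 ≤ d → ∀ lam : ℝ, 0 < lam →
    ∃ c : ℝ, 0 < c ∧
      ∀ (Ω : Type) [MeasurableSpace Ω] (P : Measure Ω) [IsProbabilityMeasure P]
        (Φ : Ω → Measure (EuclideanSpace ℝ (Fin d))),
        Measurable Φ →
        -- `Φ` is a point process: almost surely a Radon counting measure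
        (∀ᵐ ω ∂P, ∀ B : Set (EuclideanSpace ℝ (Fin d)),
          MeasurableSet B → Bornology.IsBounded B → ∃ n : ℕ, Φ ω B = n) →
        -- `Φ` is simple
        (∀ᵐ ω ∂P, ∀ x, Φ ω {x} ≤ 1) →
        -- `Φ` is stationary
        (∀ v : EuclideanSpace ℝ (Fin d),
          P.map (fun ω => (Φ ω).map (fun x => v + x)) = P.map Φ) →
        -- `Φ` has intensity `lam`
        (∀ B : Set (EuclideanSpace ℝ (Fin d)), MeasurableSet B →
          ∫⁻ ω, Φ ω B ∂P = ENNReal.ofReal lam * volume B) →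
        -- `Φ` is α-weakly sub-Poisson
        (∀ (k : ℕ) (B : Fin k → Set (EuclideanSpace ℝ (Fin d))),
          (∀ i, MeasurableSet (B i) ∧ Bornology.IsBounded (B i)) →
          Pairwise (Function.onFun Disjoint B) →
          ∫⁻ ω, ∏ i, Φ ω (B i) ∂P ≤ ∏ i, ∫⁻ ω, Φ ω (B i) ∂P) →
        ∀ r : ℝ, r < c →
          P {ω | Percolates (BooleanModel (Φ ω) r)} = 0 := by
  intro d hd lam _
  obtain ⟨s, hs, hsmall⟩ := exists_side_length (d := d) (by omega) lam
  refine ⟨s / 2, by positivity, ?_⟩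
  intro Ω _ P _ Φ hΦ hcount _ _ hint hsub r hr
  set ε := ENNReal.ofReal lam * ENNReal.ofReal s ^ d
  set E : (Fin d → ℤ) → ℕ → Set Ω := fun z n =>
    ⋃ g ∈ {g | g ∈ latticeSteps d n ∧ Function.Injective (incrementPath z g)},
      {ω | ∀ i, 1 ≤ Φ ω (latticeCube s (incrementPath z g i))} with hE
  have hEbound (z : Fin d → ℤ) (n : ℕ) : P (E z n) ≤ (ε * 3 ^ d) ^ n * ε := by
    classical
    have hset : E z n = ⋃ g ∈ (latticeSteps d n).filter
        (fun g => Function.Injective (incrementPath z g)),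
        {ω | ∀ i, 1 ≤ Φ ω (latticeCube s (incrementPath z g i))} := by
      simp [hE]
    rw [hset]
    calc _ ≤ ∑ g ∈ (latticeSteps d n).filter (fun g => Function.Injective (incrementPath z g)),
          P {ω | ∀ i, 1 ≤ Φ ω (latticeCube s (incrementPath z g i))} :=
        measure_biUnion_finset_le _ _
      _ ≤ ∑ g ∈ (latticeSteps d n).filter (fun g => Function.Injective (incrementPath z g)),
          ε ^ (n + 1) := by
        refine Finset.sum_le_sum fun g hg => ?_
        refine measure_forall_one_le_le hΦ (fun i => measurableSet_latticeCube _ _)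
          (hsub _ _ (fun i => ⟨measurableSet_latticeCube _ _, isBounded_latticeCube hs _⟩)
            fun i j hij => disjoint_latticeCube s ((Finset.mem_filter.1 hg).2.ne hij))
          fun i => ?_
        rw [hint _ (measurableSet_latticeCube _ _)]
        exact mul_le_mul' le_rfl (volume_latticeCube_le hs _)
      _ ≤ ((3 ^ d) ^ n : ℕ) * ε ^ (n + 1) := by
        rw [Finset.sum_const, nsmul_eq_mul, ← card_latticeSteps]
        gcongr
        exact Finset.filter_subset _ _
      _ = (ε * 3 ^ d) ^ n * ε := by
        push_cast
        ring
  have hlim : Filter.Tendsto (fun n : ℕ => (ε * 3 ^ d) ^ n * ε) Filter.atTop (nhds 0) := by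
    have hεtop : ε ≠ ⊤ := ENNReal.mul_ne_top ofReal_ne_top (ENNReal.pow_ne_top ofReal_ne_top)
    simpa using ENNReal.Tendsto.mul_const
      (ENNReal.tendsto_pow_atTop_nhds_zero_of_lt_one hsmall) (Or.inr hεtop)
  have hnull : P (⋃ z, ⋂ n, E z n) = 0 := by
    refine measure_iUnion_null fun z => le_antisymm ?_ zero_le
    exact ge_of_tendsto' hlim fun n =>
      (measure_mono (Set.iInter_subset _ n)).trans (hEbound z n)
  rw [← compl_compl {ω | Percolates (BooleanModel (Φ ω) r)}]
  change ∀ᵐ ω ∂P, ¬ Percolates (BooleanModel (Φ ω) r)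
  filter_upwards [hcount, measure_eq_zero_iff_ae_notMem.1 hnull] with ω hω hωE hperc
  obtain ⟨z, hz⟩ := hperc.exists_incrementPath hs hr
  refine hωE (Set.mem_iUnion.2 ⟨z, Set.mem_iInter.2 fun n => ?_⟩)
  obtain ⟨g, hg, hinj, hocc⟩ := hz n
  refine Set.mem_biUnion
    (show g ∈ {g | g ∈ latticeSteps d n ∧ Function.Injective (incrementPath z g)} from ⟨hg, hinj⟩)
    fun i => ?_
  obtain ⟨x, hx, hxa⟩ := hocc i
  obtain ⟨m, hm⟩ := hω _ (measurableSet_latticeCube s (incrementPath z g i))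
    (isBounded_latticeCube hs _)
  have hne : Φ ω (latticeCube s (incrementPath z g i)) ≠ 0 := fun h0 =>
    hxa (measure_mono_null (Set.singleton_subset_iff.2 hx) h0)
  rw [hm] at hne ⊢
  exact_mod_cast Nat.one_le_iff_ne_zero.2 (by exact_mod_cast hne)
end
end

section
/- For every dimension d ≥ 2, every k ≥ 1 and every intensity λ > 0 there exists a constant c(λ,k) < ∞, depending only on λ, k and d (and not on the distribution of the point process), such that every simple, stationary, ν-weakly sub-Poisson point process Φ on ℝ^d of intensity λ satisfies r_c^k(Φ) ≤ c(λ,k); that is, for all radii r > c(λ,k) the k-covered set C_k(Φ,r) percolates with positive probability. -/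
open MeasureTheory ENNReal Metric

noncomputable section

/-- The `k`-covered set `C_k(Φ,r) = {y : V_{Φ,r}(y) ≥ k}`, where the coverage number
field is `V_{Φ,r}(y) = Σ_{X ∈ Φ} 1[y ∈ B_r(X)] = Φ(B_r(y))` for a counting measure. -/
def coveredSet {d : ℕ} (μ : Measure (EuclideanSpace ℝ (Fin d))) (r : ℝ) (k : ℕ) :
    Set (EuclideanSpace ℝ (Fin d)) :=
  {y | (k : ℝ≥0∞) ≤ μ (closedBall y r)}

/-- Backward moves of an admissible lattice path: `none` undoes an upward step, and `some j`
undoes a downward step with horizontal displacement in `{-1, 0, 1}`. -/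
def backMove (σ : Option (Fin 3)) (p : ℤ × ℤ) : ℤ × ℤ :=
  match σ with
  | none => (p.1, p.2 - 1)
  | some j => (p.1 + ((j : ℕ) : ℤ) - 1, p.2 + 1)

/-- `AdmissiblyReachable A n p`: the site `p` is reached from the lower half-plane by an
admissible path with `n` steps, where upward steps must end in `A` and downward steps (possibly
diagonal) are free. -/
inductive AdmissiblyReachable (A : Set (ℤ × ℤ)) : ℕ → ℤ × ℤ → Prop
  | base (p : ℤ × ℤ) (hp : p.2 ≤ 0) : AdmissiblyReachable A 0 p
  | step (p : ℤ × ℤ) (σ : Option (Fin 3)) (n : ℕ) (hσ : σ = none → p ∈ A)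
      (h : AdmissiblyReachable A n (backMove σ p)) : AdmissiblyReachable A (n + 1) p

/-- The endpoints of the upward steps of the path ending at `p` with backward moves `w`. -/
def upSites : List (Option (Fin 3)) → ℤ × ℤ → Finset (ℤ × ℤ)
  | [], _ => ∅
  | none :: w, p => insert p (upSites w (backMove none p))
  | some j :: w, p => upSites w (backMove (some j) p)

/-- A shortest admissible path visits distinct sites, so its upward steps use many sites
of `A`. -/
theorem exists_upSites_of_admissiblyReachable {A : Set (ℤ × ℤ)} (n : ℕ) (p : ℤ × ℤ)
    (h : AdmissiblyReachable A n p) (hmin : ∀ m < n, ¬ AdmissiblyReachable A m p) :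
    ∃ w : List (Option (Fin 3)), w.length = n ∧ (∀ q ∈ upSites w p, q ∈ A) ∧
      (∀ q ∈ upSites w p, ∃ m ≤ n, AdmissiblyReachable A m q) ∧
      (n : ℤ) + p.2 ≤ 2 * ((upSites w p).card : ℤ) := by
  induction n generalizing p with
  | zero =>
    cases h with
    | base _ hp => exact ⟨[], rfl, by simp [upSites], by simp [upSites], by simpa [upSites] using hp⟩
  | succ n ih =>
    cases h with
    | step _ σ _ hσ h =>
      obtain ⟨w, hw, hA, hR, hc⟩ := ih _ h fun m hm hm' =>
        hmin (m + 1) (by omega) (.step p σ m hσ hm')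
      refine ⟨σ :: w, by simp [hw], ?_⟩
      cases σ with
      | none =>
        have hp : p ∉ upSites w (backMove none p) := fun hp => by
          obtain ⟨m, hm, hm'⟩ := hR p hp
          exact hmin m (by omega) hm'
        refine ⟨?_, ?_, ?_⟩
        · intro q hq
          rcases Finset.mem_insert.1 hq with rfl | hq
          · exact hσ rfl
          · exact hA q hq
        · intro q hq
          rcases Finset.mem_insert.1 hq with rfl | hq
          · exact ⟨n + 1, le_rfl, .step _ none n hσ h⟩
          · obtain ⟨m, hm, hm'⟩ := hR q hq
            exact ⟨m, by omega, hm'⟩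
        · rw [upSites, Finset.card_insert_of_notMem hp]
          simp only [backMove] at hc ⊢
          push_cast
          linarith
      | some j =>
        refine ⟨hA, fun q hq => ?_, ?_⟩
        · obtain ⟨m, hm, hm'⟩ := hR q hq
          exact ⟨m, by omega, hm'⟩
        · rw [upSites]
          simp only [backMove] at hc ⊢
          push_cast
          linarith

/-- If `(0, 1)` is not admissibly reachable, there is a Lipschitz path avoiding `A`. -/
theorem exists_lipschitz_path_avoiding {A : Set (ℤ × ℤ)}
    (h : ∀ n, ¬ AdmissiblyReachable A n (0, 1)) :
    ∃ f : ℕ → ℤ, (∀ x : ℕ, ((x : ℤ), f x) ∉ A) ∧ ∀ x, |f (x + 1) - f x| ≤ 1 := by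
  classical
  set R : Set (ℤ × ℤ) := {p | ∃ n, AdmissiblyReachable A n p} with hR
  have hback : ∀ p, p ∉ R → ∀ j : Fin 3, backMove (some j) p ∉ R := by
    rintro p hp j ⟨n, hn⟩
    exact hp ⟨n + 1, .step p (some j) n (by simp) hn⟩
  have hright : ∀ x y : ℤ, (x, y) ∉ R → (x + 1, y + 1) ∉ R := fun x y hxy => by
    have := hback _ hxy 2
    simp only [backMove] at this
    convert this using 3
    norm_num
    ring
  have hleft : ∀ x y : ℤ, (x + 1, y) ∉ R → (x, y + 1) ∉ R := fun x y hxy => by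
    have := hback _ hxy 0
    simp only [backMove] at this
    convert this using 3
    norm_num
  have hex : ∀ x : ℕ, ∃ n : ℕ, ((x : ℤ), (n : ℤ)) ∉ R := by
    intro x
    induction x with
    | zero => exact ⟨1, by rintro ⟨n, hn⟩; exact h n (by simpa using hn)⟩
    | succ x ih =>
      obtain ⟨n, hn⟩ := ih
      exact ⟨n + 1, by simpa using hright _ _ hn⟩
  refine ⟨fun x => (Nat.find (hex x) : ℤ), fun x hxA => ?_, fun x => ?_⟩
  · have hpos : Nat.find (hex x) ≠ 0 := by
      intro h0
      have := Nat.find_spec (hex x)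
      rw [h0] at this
      exact this ⟨0, .base _ (by simp)⟩
    obtain ⟨m, hm⟩ := Nat.exists_eq_succ_of_ne_zero hpos
    have hmR := Nat.find_min (hex x) (m := m) (by omega)
    obtain ⟨n, hn⟩ := not_not.1 hmR
    refine Nat.find_spec (hex x) ⟨n + 1, .step _ none n (fun _ => hxA) ?_⟩
    rw [hm]
    simpa [backMove] using hn
  · have h1 : Nat.find (hex (x + 1)) ≤ Nat.find (hex x) + 1 :=
      Nat.find_min' _ (by simpa using hright _ _ (Nat.find_spec (hex x)))
    have h2 : Nat.find (hex x) ≤ Nat.find (hex (x + 1)) + 1 :=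
      Nat.find_min' _ (by
        have := Nat.find_spec (hex (x + 1))
        push_cast at this ⊢
        exact hleft _ _ this)
    simp only [abs_le]
    constructor <;> omega

/-- Peierls-type bound: if any finite set of sites lies in the random set `A` with probability
exponentially small in its size, then `(0, 1)` is reachable with probability at most `1/4`. -/
theorem measure_admissiblyReachable_le {Ω : Type*} [MeasurableSpace Ω] (P : Measure Ω)
    (A : Ω → Set (ℤ × ℤ))
    (hA : ∀ S : Finset (ℤ × ℤ), P {ω | ∀ q ∈ S, q ∈ A ω} ≤ ENNReal.ofReal ((1 / 64) ^ S.card)) :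
    P {ω | ∃ n, AdmissiblyReachable (A ω) n (0, 1)} ≤ ENNReal.ofReal (1 / 4) := by
  classical
  let E : (n : ℕ) → List.Vector (Option (Fin 3)) n → Set Ω := fun n w =>
    {ω | n + 1 ≤ 2 * (upSites w.1 (0, 1)).card ∧ ∀ q ∈ upSites w.1 (0, 1), q ∈ A ω}
  have hsub : {ω | ∃ n, AdmissiblyReachable (A ω) n (0, 1)} ⊆ ⋃ n, ⋃ w, E n w := by
    intro ω hω
    obtain ⟨w, hw, hwA, -, hc⟩ := exists_upSites_of_admissiblyReachable _ _ (Nat.find_spec hω)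
      fun m hm => Nat.find_min hω hm
    refine Set.mem_iUnion₂.2 ⟨_, ⟨w, hw⟩, ?_, hwA⟩
    simp only at hc ⊢
    omega
  have hE : ∀ n w, P (E n w) ≤ ENNReal.ofReal ((1 / 8) ^ (n + 1)) := by
    intro n w
    by_cases hn : n + 1 ≤ 2 * (upSites w.1 (0, 1)).card
    · refine (measure_mono fun ω hω => hω.2).trans ((hA _).trans (ENNReal.ofReal_le_ofReal ?_))
      rw [show (1 / 64 : ℝ) = (1 / 8) ^ 2 by norm_num, ← pow_mul]
      exact pow_le_pow_of_le_one (by norm_num) (by norm_num) hn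
    · have : E n w = ∅ := Set.eq_empty_of_forall_notMem fun ω hω => hn hω.1
      simp [this]
  have hsum : HasSum (fun n : ℕ => (1 / 8 : ℝ) * (1 / 2) ^ n) (1 / 4) := by
    have := hasSum_geometric_two.mul_left (1 / 8 : ℝ)
    norm_num at this ⊢
    exact this
  calc P {ω | ∃ n, AdmissiblyReachable (A ω) n (0, 1)}
      ≤ P (⋃ n, ⋃ w, E n w) := measure_mono hsub
    _ ≤ ∑' n, P (⋃ w, E n w) := measure_iUnion_le _
    _ ≤ ∑' n : ℕ, ENNReal.ofReal ((1 / 8 : ℝ) * (1 / 2) ^ n) := by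
        refine ENNReal.tsum_le_tsum fun n => ?_
        calc P (⋃ w, E n w) ≤ ∑ w, P (E n w) := measure_iUnion_fintype_le _ _
          _ ≤ ∑ _w : List.Vector (Option (Fin 3)) n, ENNReal.ofReal ((1 / 8) ^ (n + 1)) :=
              Finset.sum_le_sum fun w _ => hE n w
          _ = ENNReal.ofReal ((1 / 8 : ℝ) * (1 / 2) ^ n) := by
              rw [Finset.sum_const, Finset.card_univ, card_vector, ← ENNReal.ofReal_nsmul]
              congr 1
              simp only [Fintype.card_option, Fintype.card_fin, nsmul_eq_mul]
              push_cast
              rw [show (1 / 2 : ℝ) = 4 * (1 / 8) by norm_num, mul_pow]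
              ring
    _ = ENNReal.ofReal (1 / 4) := by
        rw [← ENNReal.ofReal_tsum_of_nonneg (fun n => by positivity) hsum.summable, hsum.tsum_eq]

/-- The point of `ℝ^d` with first coordinates `a * q.1`, `a * q.2` and the others zero. -/
def planarPoint {d : ℕ} (hd : 2 ≤ d) (a : ℝ) (q : ℤ × ℤ) : EuclideanSpace ℝ (Fin d) :=
  EuclideanSpace.single ⟨0, by omega⟩ (a * q.1) + EuclideanSpace.single ⟨1, by omega⟩ (a * q.2)

theorem planarPoint_apply_zero {d : ℕ} (hd : 2 ≤ d) (a : ℝ) (q : ℤ × ℤ) :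
    planarPoint hd a q ⟨0, by omega⟩ = a * q.1 := by
  simp [planarPoint]

theorem planarPoint_apply_one {d : ℕ} (hd : 2 ≤ d) (a : ℝ) (q : ℤ × ℤ) :
    planarPoint hd a q ⟨1, by omega⟩ = a * q.2 := by
  simp [planarPoint]

theorem dist_planarPoint_le {d : ℕ} (hd : 2 ≤ d) {a : ℝ} (ha : 0 ≤ a) (p q : ℤ × ℤ) :
    dist (planarPoint hd a p) (planarPoint hd a q) ≤
      a * (|((p.1 - q.1 : ℤ) : ℝ)| + |((p.2 - q.2 : ℤ) : ℝ)|) := by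
  refine (dist_add_add_le _ _ _ _).trans (le_of_eq ?_)
  rw [PiLp.dist_single_same, PiLp.dist_single_same, Real.dist_eq, Real.dist_eq,
    ← mul_sub, ← mul_sub, abs_mul, abs_mul, abs_of_nonneg ha]
  push_cast
  ring

theorem le_dist_planarPoint {d : ℕ} (hd : 2 ≤ d) {a : ℝ} (ha : 0 ≤ a) {p q : ℤ × ℤ}
    (hpq : p ≠ q) : a ≤ dist (planarPoint hd a p) (planarPoint hd a q) := by
  have key : ∀ m n : ℤ, m ≠ n → a ≤ |a * m - a * n| := by
    intro m n hmn
    rw [← mul_sub, abs_mul, abs_of_nonneg ha]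
    have : (1 : ℝ) ≤ |(m : ℝ) - n| := by
      exact_mod_cast Int.one_le_abs (sub_ne_zero.2 hmn)
    nlinarith
  have hcoord : ∀ i, |planarPoint hd a p i - planarPoint hd a q i| ≤
      dist (planarPoint hd a p) (planarPoint hd a q) := fun i => by
    rw [dist_eq_norm]
    simpa using PiLp.norm_apply_le (planarPoint hd a p - planarPoint hd a q) i
  by_cases h1 : p.1 = q.1
  · have h2 : p.2 ≠ q.2 := fun h2 => hpq (Prod.ext h1 h2)
    have := hcoord ⟨1, by omega⟩
    rw [planarPoint_apply_one, planarPoint_apply_one] at this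
    exact (key _ _ h2).trans this
  · have := hcoord ⟨0, by omega⟩
    rw [planarPoint_apply_zero, planarPoint_apply_zero] at this
    exact (key _ _ h1).trans this

/-- Disjoint balls centred at the sites of a planar lattice of mesh `3 * a`. -/
def latticeBall {d : ℕ} (hd : 2 ≤ d) (a : ℝ) (q : ℤ × ℤ) : Set (EuclideanSpace ℝ (Fin d)) :=
  ball (planarPoint hd (3 * a) q) a

theorem measurableSet_latticeBall {d : ℕ} (hd : 2 ≤ d) (a : ℝ) (q : ℤ × ℤ) :
    MeasurableSet (latticeBall hd a q) :=
  measurableSet_ball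

theorem disjoint_latticeBall {d : ℕ} (hd : 2 ≤ d) {a : ℝ} (ha : 0 ≤ a) {p q : ℤ × ℤ}
    (hpq : p ≠ q) : Disjoint (latticeBall hd a p) (latticeBall hd a q) := by
  refine ball_disjoint_ball ?_
  have := le_dist_planarPoint hd (show 0 ≤ 3 * a by linarith) hpq
  linarith

/-- The set of cells `z`, each made of the `k` lattice balls at `(k * z.1 + i, z.2)`, for which
some ball carries no mass. -/
def deficientCells {d : ℕ} (hd : 2 ≤ d) (k : ℕ) (a : ℝ)
    (μ : Measure (EuclideanSpace ℝ (Fin d))) : Set (ℤ × ℤ) :=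
  {z | ∃ i : Fin k, μ (latticeBall hd a (k * z.1 + (i : ℕ), z.2)) = 0}

theorem subcell_injective {k : ℕ} {z z' : ℤ × ℤ} {i j : Fin k}
    (h : ((k * z.1 + (i : ℕ), z.2) : ℤ × ℤ) = (k * z'.1 + (j : ℕ), z'.2)) : z = z' ∧ i = j := by
  obtain ⟨h1, h2⟩ := Prod.ext_iff.1 h
  simp only at h1 h2
  have hi := i.2
  have hj := j.2
  have hdiv : ∀ (x : ℤ) (l : Fin k), (k * x + (l : ℕ)) / (k : ℤ) = x := fun x l => by
    have hl := l.2
    rw [Int.add_comm, Int.add_mul_ediv_left _ _ (by omega),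
      Int.ediv_eq_zero_of_lt (by omega) (by omega), zero_add]
  have hz : z.1 = z'.1 := by rw [← hdiv z.1 i, h1, hdiv]
  refine ⟨Prod.ext hz h2, Fin.ext ?_⟩
  rw [hz] at h1
  omega

theorem coveredSet_of_not_mem_deficientCells {d : ℕ} (hd : 2 ≤ d) {k : ℕ} {a r : ℝ} (ha : 0 ≤ a)
    {μ : Measure (EuclideanSpace ℝ (Fin d))}
    (hμ : ∀ B : Set (EuclideanSpace ℝ (Fin d)), MeasurableSet B → Bornology.IsBounded B →
      ∃ n : ℕ, μ B = n) {z : ℤ × ℤ} (hz : z ∉ deficientCells hd k a μ)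
    {y : EuclideanSpace ℝ (Fin d)}
    (hy : dist y (planarPoint hd (3 * a) (k * z.1, z.2)) + 3 * a * k + a ≤ r) :
    y ∈ coveredSet μ r k := by
  have hball : ∀ i : Fin k, 1 ≤ μ (latticeBall hd a (k * z.1 + (i : ℕ), z.2)) := by
    intro i
    obtain ⟨n, hn⟩ := hμ (latticeBall hd a (k * z.1 + (i : ℕ), z.2))
      (measurableSet_latticeBall hd a _) isBounded_ball
    have h0 : μ (latticeBall hd a (k * z.1 + (i : ℕ), z.2)) ≠ 0 := fun h0 => hz ⟨i, h0⟩
    rw [hn] at h0 ⊢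
    exact_mod_cast Nat.one_le_iff_ne_zero.2 (by exact_mod_cast h0)
  calc (k : ℝ≥0∞) = ∑ _i : Fin k, 1 := by simp
    _ ≤ ∑ i : Fin k, μ (latticeBall hd a (k * z.1 + (i : ℕ), z.2)) :=
        Finset.sum_le_sum fun i _ => hball i
    _ = μ (⋃ i : Fin k, latticeBall hd a (k * z.1 + (i : ℕ), z.2)) := by
        rw [measure_iUnion _ fun i => measurableSet_latticeBall hd a _, tsum_fintype]
        intro i j hij
        exact disjoint_latticeBall hd ha fun h => hij (subcell_injective h).2
    _ ≤ μ (closedBall y r) := by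
        refine measure_mono (Set.iUnion_subset fun i => ?_)
        refine ball_subset_closedBall.trans (closedBall_subset_closedBall' ?_)
        have h1 := dist_triangle_right (planarPoint hd (3 * a) (k * z.1 + (i : ℕ), z.2)) y
          (planarPoint hd (3 * a) (k * z.1, z.2))
        have h2 := dist_planarPoint_le hd (show 0 ≤ 3 * a by linarith)
          (k * z.1 + (i : ℕ), z.2) (k * z.1, z.2)
        have h3 : ((i : ℕ) : ℝ) ≤ k := by exact_mod_cast i.2.le
        simp only [add_sub_cancel_left, sub_self, Int.cast_zero, abs_zero, add_zero,
          Int.cast_natCast, Nat.abs_cast] at h2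
        have h4 : 3 * a * ((i : ℕ) : ℝ) ≤ 3 * a * k := by gcongr
        linarith

/-- A Lipschitz path of non-deficient cells makes the `k`-covered set percolate. -/
theorem percolates_coveredSet_of_path {d : ℕ} (hd : 2 ≤ d) {k : ℕ} (hk : 1 ≤ k) {a r : ℝ}
    (ha : 0 < a) (hr : 3 * a * (k + 1) + 3 * a * k + a ≤ r)
    {μ : Measure (EuclideanSpace ℝ (Fin d))}
    (hμ : ∀ B : Set (EuclideanSpace ℝ (Fin d)), MeasurableSet B → Bornology.IsBounded B →
      ∃ n : ℕ, μ B = n) (f : ℕ → ℤ)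
    (hf : ∀ x : ℕ, ((x : ℤ), f x) ∉ deficientCells hd k a μ)
    (hlip : ∀ x, |f (x + 1) - f x| ≤ 1) : Percolates (coveredSet μ r k) := by
  set c : ℕ → EuclideanSpace ℝ (Fin d) := fun x => planarPoint hd (3 * a) (k * x, f x) with hc
  have hdist : ∀ x, dist (c (x + 1)) (c x) ≤ 3 * a * (k + 1) := by
    intro x
    refine (dist_planarPoint_le hd (by positivity) _ _).trans ?_
    have h1 : |((f (x + 1) - f x : ℤ) : ℝ)| ≤ 1 := by exact_mod_cast hlip x
    have h2 : (((k : ℤ) * ((x + 1 : ℕ) : ℤ) - k * (x : ℤ) : ℤ) : ℝ) = k := by push_cast; ring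
    simp only [h2, Nat.abs_cast]
    gcongr
  refine ⟨⋃ x, segment ℝ (c x) (c (x + 1)), ?_, ?_, ?_⟩
  · refine Set.iUnion_subset fun x y hy => ?_
    refine coveredSet_of_not_mem_deficientCells hd ha.le hμ (hf x) ?_
    have h1 : y ∈ closedBall (c x) (3 * a * (k + 1)) :=
      (convex_closedBall _ _).segment_subset (mem_closedBall_self (by positivity))
        (mem_closedBall.2 (hdist x)) hy
    have h2 := mem_closedBall.1 h1
    simp only [hc] at h2
    linarith
  · refine IsConnected.iUnion_of_chain (fun x => ?_) fun x => ?_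
    · exact ⟨⟨_, left_mem_segment ℝ _ _⟩, (convex_segment _ _).isPreconnected⟩
    · exact ⟨c (x + 1), right_mem_segment ℝ _ _, left_mem_segment ℝ _ _⟩
  · intro hb
    obtain ⟨M, hM⟩ := hb.exists_norm_le
    obtain ⟨x, hx⟩ := exists_nat_gt (M / (3 * a))
    have h1 := hM (c x) (Set.mem_iUnion.2 ⟨x, left_mem_segment ℝ _ _⟩)
    have h2 := PiLp.norm_apply_le (c x) ⟨0, by omega⟩
    rw [hc, planarPoint_apply_zero, Real.norm_eq_abs] at h2
    have h3 := (le_abs_self _).trans (h2.trans h1)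
    rw [div_lt_iff₀ (by positivity)] at hx
    have h4 : (1 : ℝ) ≤ k := by exact_mod_cast hk
    push_cast at h3
    have h5 : (x : ℝ) * (3 * a) ≤ 3 * a * (k * x) := by
      nlinarith [mul_nonneg (mul_nonneg (show (0 : ℝ) ≤ 3 by norm_num) ha.le)
        (mul_nonneg (sub_nonneg.2 h4) (Nat.cast_nonneg (α := ℝ) x))]
    linarith

/-- For a ν-weakly sub-Poisson process, a finite set of cells is entirely deficient with
probability at most `(k * exp (-m)) ^ n`, where `n` is the number of cells and `m` the mean number
of points in a lattice ball. -/
theorem measure_subset_deficientCells_le {d : ℕ} (hd : 2 ≤ d) (k : ℕ) {a : ℝ} (ha : 0 ≤ a)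
    {lam : ℝ} (hlam : 0 ≤ lam) {Ω : Type*} [MeasurableSpace Ω] (P : Measure Ω)
    (Φ : Ω → Measure (EuclideanSpace ℝ (Fin d)))
    (hint : ∀ B : Set (EuclideanSpace ℝ (Fin d)), MeasurableSet B →
      ∫⁻ ω, Φ ω B ∂P = ENNReal.ofReal lam * volume B)
    (hvoid : ∀ B : Set (EuclideanSpace ℝ (Fin d)), MeasurableSet B → Bornology.IsBounded B →
      P {ω | Φ ω B = 0} ≤ ENNReal.ofReal (Real.exp (-(∫⁻ ω, Φ ω B ∂P).toReal)))
    (S : Finset (ℤ × ℤ)) :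
    P {ω | ∀ z ∈ S, z ∈ deficientCells hd k a (Φ ω)} ≤ ENNReal.ofReal
      ((k * Real.exp (-(lam * volume.real (ball (0 : EuclideanSpace ℝ (Fin d)) a)))) ^ S.card) := by
  classical
  let site : (S → Fin k) → S → ℤ × ℤ := fun g z => (k * z.1.1 + (g z : ℕ), z.1.2)
  let U : (S → Fin k) → Set (EuclideanSpace ℝ (Fin d)) := fun g => ⋃ z, latticeBall hd a (site g z)
  have hUmeas : ∀ g, MeasurableSet (U g) := fun g => .iUnion fun z => measurableSet_latticeBall hd a _
  have hUbdd : ∀ g, Bornology.IsBounded (U g) := fun g =>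
    Bornology.isBounded_iUnion.2 fun z => isBounded_ball
  have hUvol : ∀ g, volume (U g) =
      S.card * volume (ball (0 : EuclideanSpace ℝ (Fin d)) a) := by
    intro g
    rw [measure_iUnion _ fun z => measurableSet_latticeBall hd a _, tsum_fintype]
    · simp [latticeBall, Measure.addHaar_ball_center]
    · intro z z' hzz'
      exact disjoint_latticeBall hd ha fun h => hzz' (Subtype.ext (subcell_injective h).1)
  have hsub : {ω | ∀ z ∈ S, z ∈ deficientCells hd k a (Φ ω)} ⊆ ⋃ g, {ω | Φ ω (U g) = 0} := by
    intro ω hω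
    choose g hg using fun z : S => hω z.1 z.2
    exact Set.mem_iUnion.2 ⟨g, measure_iUnion_null hg⟩
  calc P {ω | ∀ z ∈ S, z ∈ deficientCells hd k a (Φ ω)}
      ≤ P (⋃ g, {ω | Φ ω (U g) = 0}) := measure_mono hsub
    _ ≤ ∑ g, P {ω | Φ ω (U g) = 0} := measure_iUnion_fintype_le _ _
    _ ≤ ∑ _g : S → Fin k, ENNReal.ofReal (Real.exp
          (-(lam * volume.real (ball (0 : EuclideanSpace ℝ (Fin d)) a))) ^ S.card) := by
        refine Finset.sum_le_sum fun g _ => (hvoid _ (hUmeas g) (hUbdd g)).trans (le_of_eq ?_)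
        rw [hint _ (hUmeas g), hUvol g, ← Real.exp_nat_mul, ENNReal.toReal_mul, ENNReal.toReal_mul,
          ENNReal.toReal_ofReal hlam, ENNReal.toReal_natCast, measureReal_def]
        congr 2
        ring
    _ = _ := by
        rw [Finset.sum_const, Finset.card_univ, ← ENNReal.ofReal_nsmul, mul_pow]
        simp

/-- Large balls have large volume. -/
theorem exists_radius_mul_exp_neg_le {d : ℕ} (hd : 2 ≤ d) (k : ℕ) {lam : ℝ} (hlam : 0 < lam) :
    ∃ a : ℝ, 0 < a ∧
      k * Real.exp (-(lam * volume.real (ball (0 : EuclideanSpace ℝ (Fin d)) a))) ≤ 1 / 64 := by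
  set v := volume.real (ball (0 : EuclideanSpace ℝ (Fin d)) 1) with hv
  have hvpos : 0 < v := ENNReal.toReal_pos (measure_ball_pos _ _ one_pos).ne' measure_ball_lt_top.ne
  have hvol : ∀ a : ℝ, 0 < a → volume.real (ball (0 : EuclideanSpace ℝ (Fin d)) a) = a ^ d * v := by
    intro a ha
    rw [measureReal_def, Measure.addHaar_ball_of_pos _ _ ha, ENNReal.toReal_mul,
      ENNReal.toReal_ofReal (by positivity), finrank_euclideanSpace_fin, hv, measureReal_def]
  have hlim : Filter.Tendsto (fun a : ℝ => (k : ℝ) * Real.exp (-(lam * (a ^ d * v))))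
      Filter.atTop (nhds (k * 0)) := by
    refine (Real.tendsto_exp_neg_atTop_nhds_zero.comp ?_).const_mul _
    exact ((Filter.tendsto_pow_atTop (by omega)).atTop_mul_const hvpos).const_mul_atTop hlam
  rw [mul_zero] at hlim
  obtain ⟨a, ha, hpos⟩ := ((hlim.eventually_le_const (show (0 : ℝ) < 1 / 64 by norm_num)).and
    (Filter.eventually_gt_atTop 0)).exists
  exact ⟨a, hpos, by rwa [hvol a hpos]⟩

/-- for every dimension `d ≥ 2`, every `k ≥ 1` and every intensity `λ > 0`
there is a finite constant `c(λ,k)`, not depending on the distribution of the point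
process, such that for every simple, stationary, ν-weakly sub-Poisson point process `Φ`
of intensity `λ` and every radius `r > c(λ,k)` the `k`-covered set `C_k(Φ,r)`
percolates with positive probability (equivalently, `r_c^k(Φ) ≤ c(λ,k)`). -/
theorem k_percolation_upper_bound_of_nuWeaklySubPoisson :
    ∀ d : ℕ, 2 ≤ d → ∀ k : ℕ, 1 ≤ k → ∀ lam : ℝ, 0 < lam →
    ∃ c : ℝ,
      ∀ (Ω : Type) [MeasurableSpace Ω] (P : Measure Ω) [IsProbabilityMeasure P]
        (Φ : Ω → Measure (EuclideanSpace ℝ (Fin d))),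
        Measurable Φ →
        -- `Φ` is a point process: almost surely a Radon counting measure
        (∀ᵐ ω ∂P, ∀ B : Set (EuclideanSpace ℝ (Fin d)),
          MeasurableSet B → Bornology.IsBounded B → ∃ n : ℕ, Φ ω B = n) →
        -- `Φ` is simple
        (∀ᵐ ω ∂P, ∀ x, Φ ω {x} ≤ 1) →
        -- `Φ` is stationary
        (∀ v : EuclideanSpace ℝ (Fin d),
          P.map (fun ω => (Φ ω).map (fun x => v + x)) = P.map Φ) →
        -- `Φ` has intensity `lam`
        (∀ B : Set (EuclideanSpace ℝ (Fin d)), MeasurableSet B →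
          ∫⁻ ω, Φ ω B ∂P = ENNReal.ofReal lam * volume B) →
        -- `Φ` is ν-weakly sub-Poisson
        (∀ B : Set (EuclideanSpace ℝ (Fin d)), MeasurableSet B → Bornology.IsBounded B →
          P {ω | Φ ω B = 0} ≤ ENNReal.ofReal (Real.exp (-(∫⁻ ω, Φ ω B ∂P).toReal))) →
        ∀ r : ℝ, c < r →
          0 < P {ω | Percolates (coveredSet (Φ ω) r k)} := by
  intro d hd k hk lam hlam
  obtain ⟨a, ha, hsmall⟩ := exists_radius_mul_exp_neg_le hd k hlam
  refine ⟨3 * a * (k + 1) + 3 * a * k + a, ?_⟩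
  intro Ω _ P _ Φ _ hcount _ _ hint hvoid r hr
  by_contra hzero
  have hnull : ∀ᵐ ω ∂P, ¬ Percolates (coveredSet (Φ ω) r k) :=
    measure_eq_zero_iff_ae_notMem.1 (le_antisymm (not_lt.1 hzero) bot_le)
  have hbad : ∀ᵐ ω ∂P, ∃ n, AdmissiblyReachable (deficientCells hd k a (Φ ω)) n (0, 1) := by
    filter_upwards [hnull, hcount] with ω hω hμ
    by_contra! hn
    obtain ⟨f, hf, hlip⟩ := exists_lipschitz_path_avoiding hn
    exact hω (percolates_coveredSet_of_path hd hk ha hr.le hμ f hf hlip)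
  have hle := measure_admissiblyReachable_le P (fun ω => deficientCells hd k a (Φ ω)) fun S =>
    (measure_subset_deficientCells_le hd k ha.le hlam.le P Φ hint hvoid S).trans
      (ENNReal.ofReal_le_ofReal (pow_le_pow_left₀ (by positivity) hsmall _))
  have hone : P {ω | ∃ n, AdmissiblyReachable (deficientCells hd k a (Φ ω)) n (0, 1)} = 1 := by
    rw [measure_congr (Filter.eventuallyEq_univ.2 hbad), measure_univ]
  rw [hone] at hle
  have : ENNReal.ofReal (1 / 4) < 1 := by
    rw [ENNReal.ofReal_lt_one]
    norm_num
  exact absurd hle (not_le.2 this)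
end
end

section
/- Let Φ be a simple, stationary, weakly sub-Poisson point process on ℝ^d of intensity λ. Then for every k ≥ 1 and λ > 0 there exist constants c(λ) > 0 and c(λ,k) < ∞, not depending on the distribution of Φ, such that 0 < c(λ) ≤ r_c^1(Φ) ≤ r_c^k(Φ) ≤ c(λ,k) < ∞. -/
open MeasureTheory ENNReal Metric

noncomputable section

/-- The critical radius for `k`-percolation,
`r_c^k(Φ) = inf { r : P(C_k(Φ,r) percolates) > 0 }`. -/
def criticalRadiusK {d : ℕ} {Ω : Type*} [MeasurableSpace Ω] (P : Measure Ω)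
    (Φ : Ω → Measure (EuclideanSpace ℝ (Fin d))) (k : ℕ) : ℝ :=
  sInf {r : ℝ | 0 < P {ω | Percolates (coveredSet (Φ ω) r k)}}

/-- Loop erasure: two points related by the reflexive transitive closure of `R` are joined by a
self-avoiding `R`-path. -/
lemma exists_injOn_path {V : Type*} {R : V → V → Prop} {a b : V}
    (hab : Relation.ReflTransGen R a b) :
    ∃ (N : ℕ) (p : ℕ → V), p 0 = a ∧ p N = b ∧ (∀ i < N, R (p i) (p (i + 1))) ∧
      Set.InjOn p (Set.Iic N) := by
  classical
  have hex : ∃ (N : ℕ) (p : ℕ → V), p 0 = a ∧ p N = b ∧ ∀ i < N, R (p i) (p (i + 1)) := by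
    induction hab with
    | refl => exact ⟨0, fun _ => a, rfl, rfl, by simp⟩
    | @tail b c _ hbc ih =>
      obtain ⟨N, p, h0, hN, hp⟩ := ih
      refine ⟨N + 1, fun i => if i ≤ N then p i else c, by simp [h0], by simp, fun i hi => ?_⟩
      rcases Nat.lt_succ_iff_lt_or_eq.mp hi with hi | rfl
      · simpa [hi.le, Nat.succ_le_of_lt hi] using hp i hi
      · simpa [hN] using hbc
  obtain ⟨p, h0, hN, hp⟩ := Nat.find_spec hex
  refine ⟨Nat.find hex, p, h0, hN, hp, ?_⟩
  have key : ∀ i j : ℕ, i < j → j ≤ Nat.find hex → p i ≠ p j := by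
    intro i j hij hj heq
    refine Nat.find_min hex (m := Nat.find hex - (j - i)) (by omega)
      ⟨fun m => if m ≤ i then p m else p (m + (j - i)), by simp [h0], ?_, fun m hm => ?_⟩
    · rcases Nat.lt_or_ge i (Nat.find hex - (j - i)) with h | h
      · have h2 : Nat.find hex - (j - i) + (j - i) = Nat.find hex := by omega
        simp only [not_le.mpr h, if_false, h2, hN]
      · have h2 : Nat.find hex - (j - i) = i := by omega
        have h3 : j = Nat.find hex := by omega
        simp only [h2, le_refl, if_true, heq]
        rw [h3, hN]
    · rcases lt_trichotomy m i with h | h | h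
      · simpa [h.le, Nat.succ_le_of_lt h] using hp m (by omega)
      · subst h
        have h2 : m + 1 + (j - m) = j + 1 := by omega
        simpa [heq, h2] using hp j (by omega)
      · have h2 : m + 1 + (j - i) = m + (j - i) + 1 := by omega
        simpa [not_le.mpr h, not_le.mpr (Nat.lt_succ_of_lt h), h2] using
          hp (m + (j - i)) (by omega)
  intro i hi j hj hij
  rcases lt_trichotomy i j with h | h | h
  · exact absurd hij (key i j h hj)
  · exact h
  · exact absurd hij.symm (key j i h hi)

/-- Up to their values after time `N`, there are at most `|S| ^ N` paths of length `N` with steps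
in `S` from a given starting point. -/
lemma exists_finset_paths {V : Type*} [AddCommGroup V] (S : Finset V) (v : V) (N : ℕ) :
    ∃ F : Finset (ℕ → V), F.card ≤ S.card ^ N ∧
      ∀ p : ℕ → V, p 0 = v → (∀ i < N, p (i + 1) - p i ∈ S) →
        ∃ q ∈ F, ∀ i ≤ N, q i = p i := by
  classical
  induction N with
  | zero => exact ⟨{fun _ => v}, by simp, fun p hp _ => ⟨fun _ => v, by simp, by simp [hp]⟩⟩
  | succ N ih =>
    obtain ⟨F, hF, hF'⟩ := ih
    refine ⟨(F ×ˢ S).image (fun x i => if i ≤ N then x.1 i else x.1 N + x.2), ?_, ?_⟩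
    · refine Finset.card_image_le.trans ?_
      rw [Finset.card_product, pow_succ]
      exact Nat.mul_le_mul_right _ hF
    · intro p h0 hp
      obtain ⟨q, hq, hqp⟩ := hF' p h0 (fun i hi => hp i (by omega))
      refine ⟨_, Finset.mem_image_of_mem _
        (Finset.mk_mem_product hq (hp N (Nat.lt_succ_self N))), fun i hi => ?_⟩
      rcases Nat.lt_succ_iff_lt_or_eq.mp (Nat.lt_succ_of_le hi) with h | rfl
      · simp [Nat.lt_succ_iff.mp h, hqp i (Nat.lt_succ_iff.mp h)]
      · simp [hqp N le_rfl]

/-- Union bound over paths of length `N` with steps in `S` from a given starting point. -/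
lemma measure_exists_path_le {Ω V : Type*} [MeasurableSpace Ω] (P : Measure Ω) [AddCommGroup V]
    (S : Finset V) (v : V) (N : ℕ) (A : (ℕ → V) → Set Ω) (ε : ℝ≥0∞)
    (hcongr : ∀ p q : ℕ → V, (∀ i ≤ N, q i = p i) → A p ⊆ A q) (hA : ∀ p, P (A p) ≤ ε) :
    P {ω | ∃ p : ℕ → V, p 0 = v ∧ (∀ i < N, p (i + 1) - p i ∈ S) ∧ ω ∈ A p} ≤
      (S.card : ℝ≥0∞) ^ N * ε := by
  obtain ⟨F, hF, hF'⟩ := exists_finset_paths S v N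
  calc P {ω | ∃ p : ℕ → V, p 0 = v ∧ (∀ i < N, p (i + 1) - p i ∈ S) ∧ ω ∈ A p}
      ≤ P (⋃ q ∈ F, A q) := by
        refine measure_mono fun ω => ?_
        rintro ⟨p, h0, hp, hω⟩
        obtain ⟨q, hq, hqp⟩ := hF' p h0 hp
        exact Set.mem_biUnion hq (hcongr p q hqp hω)
    _ ≤ ∑ q ∈ F, P (A q) := measure_biUnion_finset_le _ _
    _ ≤ ∑ _q ∈ F, ε := Finset.sum_le_sum fun q _ => hA q
    _ = F.card * ε := by simp
    _ ≤ (S.card : ℝ≥0∞) ^ N * ε := by gcongr; exact_mod_cast hF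

/-- The half-open cube of side `h` with index `z` in the grid `h ℤ^d`. -/
def gridCell {d : ℕ} (h : ℝ) (z : Fin d → ℤ) : Set (EuclideanSpace ℝ (Fin d)) :=
  {y | ∀ i, h * z i ≤ y i ∧ y i < h * (z i + 1)}

lemma gridCell_eq_preimage {d : ℕ} (h : ℝ) (z : Fin d → ℤ) :
    gridCell h z = (MeasurableEquiv.toLp 2 (Fin d → ℝ)).symm ⁻¹'
      Set.pi Set.univ (fun i => Set.Ico (h * z i) (h * (z i + 1))) := by
  ext y; simp [gridCell]

lemma measurableSet_gridCell {d : ℕ} (h : ℝ) (z : Fin d → ℤ) : MeasurableSet (gridCell h z) := by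
  rw [gridCell_eq_preimage]
  exact (MeasurableEquiv.measurable _) (MeasurableSet.univ_pi fun i => measurableSet_Ico)

lemma volume_gridCell {d : ℕ} {h : ℝ} (hh : 0 < h) (z : Fin d → ℤ) :
    volume (gridCell h z) = ENNReal.ofReal (h ^ d) := by
  rw [gridCell_eq_preimage,
    (EuclideanSpace.volume_preserving_symm_measurableEquiv_toLp (Fin d)).measure_preimage
      (MeasurableSet.univ_pi fun i => measurableSet_Ico).nullMeasurableSet,
    Real.volume_pi_Ico]
  have : ∀ i, h * ((z i : ℝ) + 1) - h * z i = h := fun i => by ring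
  simp [this, ENNReal.ofReal_pow hh.le]

lemma EuclideanSpace.dist_le_sqrt_mul {d : ℕ} {x y : EuclideanSpace ℝ (Fin d)} {M : ℝ}
    (hM : 0 ≤ M) (h : ∀ i, |x i - y i| ≤ M) : dist x y ≤ √d * M := by
  rw [EuclideanSpace.dist_eq]
  refine Real.sqrt_le_iff.mpr ⟨by positivity, ?_⟩
  calc ∑ i, dist (x i) (y i) ^ 2 ≤ ∑ _i : Fin d, M ^ 2 := by
        gcongr with i
        simpa [Real.dist_eq] using h i
    _ = (√d * M) ^ 2 := by rw [mul_pow, Real.sq_sqrt (by positivity)]; simp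

lemma EuclideanSpace.abs_sub_apply_le_dist {d : ℕ} (x y : EuclideanSpace ℝ (Fin d)) (i : Fin d) :
    |x i - y i| ≤ dist x y := by
  rw [dist_eq_norm]
  simpa using PiLp.norm_apply_le (x - y) i

lemma isBounded_gridCell {d : ℕ} {h : ℝ} (hh : 0 < h) (z : Fin d → ℤ) :
    Bornology.IsBounded (gridCell h z) := by
  refine Metric.isBounded_iff.mpr ⟨√d * h, fun x hx y hy => ?_⟩
  refine EuclideanSpace.dist_le_sqrt_mul hh.le fun i => abs_le.mpr ⟨?_, ?_⟩ <;>
    nlinarith [hx i, hy i]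

lemma mem_gridCell_floor {d : ℕ} {h : ℝ} (hh : 0 < h) (y : EuclideanSpace ℝ (Fin d)) :
    y ∈ gridCell h (fun i => ⌊y i / h⌋) := by
  intro i
  have h1 := Int.floor_le (y i / h)
  have h2 := Int.lt_floor_add_one (y i / h)
  rw [le_div_iff₀ hh] at h1
  rw [div_lt_iff₀ hh] at h2
  constructor <;> linarith

/-- Indices of cubes containing points at distance `< h` differ by at most one. -/
lemma le_add_one_of_mem_gridCell {d : ℕ} {h : ℝ} (hh : 0 < h) {z w : Fin d → ℤ}
    {x y : EuclideanSpace ℝ (Fin d)} (hx : x ∈ gridCell h z) (hy : y ∈ gridCell h w)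
    (i : Fin d) (hxy : |x i - y i| < h) : z i ≤ w i + 1 := by
  have h1 := hx i
  have h2 := hy i
  have h3 := (abs_lt.mp hxy).2
  have h4 : h * z i < h * (w i + 1 + 1) := by linarith
  have h5 : (z i : ℝ) < w i + 1 + 1 := lt_of_mul_lt_mul_left h4 hh.le
  have h6 : z i < w i + 1 + 1 := by exact_mod_cast h5
  omega

lemma disjoint_gridCell {d : ℕ} {h : ℝ} (hh : 0 < h) {z w : Fin d → ℤ} (hzw : z ≠ w) :
    Disjoint (gridCell h z) (gridCell h w) := by
  refine Set.disjoint_left.mpr fun x hx hy => hzw (funext fun i => ?_)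
  have h1 : h * z i < h * (w i + 1) := (hx i).1.trans_lt (hy i).2
  have h2 : h * w i < h * (z i + 1) := (hy i).1.trans_lt (hx i).2
  have h3 : (z i : ℝ) < w i + 1 := lt_of_mul_lt_mul_left h1 hh.le
  have h4 : (w i : ℝ) < z i + 1 := lt_of_mul_lt_mul_left h2 hh.le
  have h5 : z i < w i + 1 := by exact_mod_cast h3
  have h6 : w i < z i + 1 := by exact_mod_cast h4
  omega

/-- If the `1`-covered set with small radius percolates, there are arbitrarily long self-avoiding
paths of occupied cubes from a common starting cube. -/
lemma exists_occupied_path {d : ℕ} {μ : Measure (EuclideanSpace ℝ (Fin d))} {h r : ℝ}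
    (hh : 0 < h) (hr : r < h) (hp : Percolates (coveredSet μ r 1)) :
    ∃ z : Fin d → ℤ, ∀ n : ℕ, ∃ p : ℕ → (Fin d → ℤ), p 0 = z ∧
      (∀ i < n, p (i + 1) - p i ∈ Finset.Icc (-3 : Fin d → ℤ) 3) ∧
      Set.InjOn p (Set.Iic n) ∧ ∀ i < n, μ (gridCell h (p i)) ≠ 0 := by
  obtain ⟨C, hCS, hC, hunb⟩ := hp
  have hnear : ∀ y ∈ C, ∃ z : Fin d → ℤ, μ (gridCell h z) ≠ 0 ∧
      ∃ x ∈ gridCell h z, dist x y ≤ r := by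
    intro y hy
    by_contra! hcon
    have h1 : (1 : ℝ≥0∞) ≤ μ (closedBall y r) := by simpa [coveredSet] using hCS hy
    have h2 : closedBall y r ⊆ ⋃ z ∈ {z : Fin d → ℤ | μ (gridCell h z) = 0}, gridCell h z := by
      intro x hx
      refine Set.mem_biUnion (x := fun i => ⌊x i / h⌋) ?_ (mem_gridCell_floor hh x)
      by_contra hz
      exact absurd (mem_closedBall.mp hx) (not_le.mpr (hcon _ hz x (mem_gridCell_floor hh x)))
    have h3 : μ (⋃ z ∈ {z : Fin d → ℤ | μ (gridCell h z) = 0}, gridCell h z) = 0 :=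
      (measure_biUnion_null_iff (Set.to_countable _)).mpr fun z hz => hz
    rw [measure_mono_null h2 h3] at h1
    simp at h1
  choose! g hg0 hg using hnear
  obtain ⟨y₀, hy₀⟩ := hC.nonempty
  have hclose : ∀ y ∈ C, ∀ y' ∈ C, dist y y' < h → ∀ i, g y i ≤ g y' i + 3 := by
    intro y hy y' hy' hd i
    obtain ⟨x, hx, hxy⟩ := hg y hy
    obtain ⟨x', hx', hxy'⟩ := hg y' hy'
    have e1 := le_add_one_of_mem_gridCell hh hx (mem_gridCell_floor hh y) i
      ((EuclideanSpace.abs_sub_apply_le_dist _ _ i).trans_lt (hxy.trans_lt hr))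
    have e2 := le_add_one_of_mem_gridCell hh (mem_gridCell_floor hh y)
      (mem_gridCell_floor hh y') i ((EuclideanSpace.abs_sub_apply_le_dist _ _ i).trans_lt hd)
    have e3 := le_add_one_of_mem_gridCell hh (mem_gridCell_floor hh y') hx' i
      ((EuclideanSpace.abs_sub_apply_le_dist _ _ i).trans_lt
        ((dist_comm _ _).trans_lt (hxy'.trans_lt hr)))
    linarith
  let R : (Fin d → ℤ) → (Fin d → ℤ) → Prop := fun a b =>
    μ (gridCell h a) ≠ 0 ∧ b - a ∈ Finset.Icc (-3 : Fin d → ℤ) 3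
  have hR : ∀ y ∈ C, ∀ y' ∈ C, dist y y' < h → R (g y) (g y') := by
    intro y hy y' hy' hd
    refine ⟨hg0 y hy, Finset.mem_Icc.mpr ⟨fun i => ?_, fun i => ?_⟩⟩
    · have := hclose y hy y' hy' hd i
      simp; omega
    · have := hclose y' hy' y hy ((dist_comm _ _).trans_lt hd) i
      simp; omega
  have hreach : ∀ y ∈ C, Relation.ReflTransGen R (g y₀) (g y) := by
    intro y hy
    refine hC.isPreconnected.induction₂' (fun y y' => Relation.ReflTransGen R (g y) (g y'))
      (fun x hx => ?_) (fun _ _ _ _ _ _ => Relation.ReflTransGen.trans) hy₀ hy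
    filter_upwards [self_mem_nhdsWithin, mem_nhdsWithin_of_mem_nhds (ball_mem_nhds x hh)]
      with y hy hyx
    exact ⟨.single (hR x hx y hy ((dist_comm _ _).trans_lt (mem_ball.mp hyx))),
      .single (hR y hy x hx (mem_ball.mp hyx))⟩
  refine ⟨g y₀, fun n => ?_⟩
  obtain ⟨y, hy, hfar⟩ : ∃ y ∈ C, ∃ i, 3 * (n : ℤ) < |g y i - g y₀ i| := by
    by_contra! hcon
    refine hunb (Metric.isBounded_iff.mpr ⟨√d * (h * (6 * n + 4)), fun x hx y hy => ?_⟩)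
    refine EuclideanSpace.dist_le_sqrt_mul (by positivity) fun i => ?_
    have key : ∀ x ∈ C, ∀ y ∈ C, x i - y i ≤ h * (6 * n + 4) := by
      intro x hx y hy
      obtain ⟨x', hx', hxx⟩ := hg x hx
      obtain ⟨y', hy', hyy⟩ := hg y hy
      have e1 := le_add_one_of_mem_gridCell hh (mem_gridCell_floor hh x) hx' i
        ((EuclideanSpace.abs_sub_apply_le_dist _ _ i).trans_lt
          ((dist_comm _ _).trans_lt (hxx.trans_lt hr)))
      have e2 := le_add_one_of_mem_gridCell hh hy' (mem_gridCell_floor hh y) i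
        ((EuclideanSpace.abs_sub_apply_le_dist _ _ i).trans_lt (hyy.trans_lt hr))
      have e3 := (abs_le.mp (hcon x hx i)).2
      have e4 := (abs_le.mp (hcon y hy i)).1
      have e5 : ⌊x i / h⌋ + 1 ≤ ⌊y i / h⌋ + (6 * n + 4) := by simp only at e1 e2; omega
      have e6 : ((⌊x i / h⌋ : ℝ) + 1) ≤ ⌊y i / h⌋ + (6 * n + 4) := by exact_mod_cast e5
      have e7 := (mem_gridCell_floor hh x i).2
      have e8 := (mem_gridCell_floor hh y i).1
      nlinarith [mul_le_mul_of_nonneg_left e6 hh.le]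
    exact abs_le.mpr ⟨by linarith [key y hy x hx], key x hx y hy⟩
  obtain ⟨i, hi⟩ := hfar
  obtain ⟨N, p, h0, hN, hp, hinj⟩ := exists_injOn_path (hreach y hy)
  have hstep : ∀ m ≤ N, |p m i - p 0 i| ≤ 3 * (m : ℤ) := by
    intro m
    induction m with
    | zero => simp
    | succ m ih =>
      intro hm
      have h1 := abs_le.mp (ih (by omega))
      have h2 := Finset.mem_Icc.mp (hp m (by omega)).2
      have h3 := h2.1 i
      have h4 := h2.2 i
      simp at h3 h4
      rw [abs_le]
      push_cast
      constructor <;> linarith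
  have hnN : n ≤ N := by
    have h1 := hstep N le_rfl
    rw [hN, h0] at h1
    omega
  exact ⟨p, h0, fun m hm => (hp m (by omega)).2,
    hinj.mono (Set.Iic_subset_Iic.mpr hnN), fun m hm => (hp m (by omega)).1⟩

/-- First-moment (subcritical) bound: there is no percolation when `h` is small and `r < h`. -/
lemma measure_percolates_eq_zero {d : ℕ} {h r : ℝ} (hh : 0 < h) (hr : r < h) {m : ℝ≥0∞}
    (hm : 7 ^ d * m ≤ 2⁻¹)
    {Ω : Type*} [MeasurableSpace Ω] {P : Measure Ω}
    {Φ : Ω → Measure (EuclideanSpace ℝ (Fin d))} (hΦ : Measurable Φ)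
    (hcount : ∀ᵐ ω ∂P, ∀ z, ∃ n : ℕ, Φ ω (gridCell h z) = n)
    (hα : ∀ (n : ℕ) (z : Fin n → Fin d → ℤ), Function.Injective z →
      ∫⁻ ω, ∏ i, Φ ω (gridCell h (z i)) ∂P ≤ m ^ n) :
    P {ω | Percolates (coveredSet (Φ ω) r 1)} = 0 := by
  let S : Finset (Fin d → ℤ) := Finset.Icc (-3) 3
  have hS : S.card = 7 ^ d := by
    rw [Pi.card_Icc]
    simp
  let A : ℕ → (ℕ → Fin d → ℤ) → Set Ω := fun n p =>
    {ω | Set.InjOn p (Set.Iic n) ∧ ∀ i < n, 1 ≤ Φ ω (gridCell h (p i))}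
  have hA : ∀ n p, P (A n p) ≤ m ^ n := by
    intro n p
    by_cases hinj : Set.InjOn p (Set.Iic n)
    · have hmeas : Measurable fun ω => ∏ i : Fin n, Φ ω (gridCell h (p i)) :=
        Finset.measurable_prod _ fun i _ =>
          (Measure.measurable_coe (measurableSet_gridCell h _)).comp hΦ
      calc P (A n p) ≤ P {ω | 1 ≤ ∏ i : Fin n, Φ ω (gridCell h (p i))} :=
            measure_mono fun ω hω => Finset.one_le_prod' fun (i : Fin n) _ => hω.2 i i.2
        _ ≤ ∫⁻ ω, ∏ i : Fin n, Φ ω (gridCell h (p i)) ∂P := by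
            simpa using mul_meas_ge_le_lintegral₀ (μ := P) hmeas.aemeasurable 1
        _ ≤ m ^ n := hα n (fun i => p i) fun i j hij =>
            Fin.ext (hinj (Set.mem_Iic.mpr i.2.le) (Set.mem_Iic.mpr j.2.le) hij)
    · have : A n p = ∅ := Set.eq_empty_of_forall_notMem fun ω hω => hinj hω.1
      simp [this]
  let E : (Fin d → ℤ) → ℕ → Set Ω := fun z n =>
    {ω | ∃ p : ℕ → Fin d → ℤ, p 0 = z ∧ (∀ i < n, p (i + 1) - p i ∈ S) ∧ ω ∈ A n p}
  have hE : ∀ z n, P (E z n) ≤ 2⁻¹ ^ n := by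
    intro z n
    refine (measure_exists_path_le P S z n (A n) (m ^ n) ?_ (hA n)).trans ?_
    · intro p q hqp ω hω
      refine ⟨hω.1.congr fun i hi => (hqp i hi).symm, fun i hi => ?_⟩
      rw [hqp i hi.le]
      exact hω.2 i hi
    · rw [hS, ← mul_pow]
      push_cast
      gcongr
  have hnull : P (⋃ z, ⋂ n, E z n) = 0 := by
    refine measure_iUnion_null fun z => le_antisymm ?_ zero_le
    refine ge_of_tendsto' (ENNReal.tendsto_pow_atTop_nhds_zero_of_lt_one
      (by simp : (2⁻¹ : ℝ≥0∞) < 1)) fun n => ?_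
    exact (measure_mono (Set.iInter_subset _ n)).trans (hE z n)
  refine measure_mono_null_ae ?_ hnull
  filter_upwards [hcount] with ω hω hperc
  obtain ⟨z, hz⟩ := exists_occupied_path hh hr hperc
  refine Set.mem_iUnion.mpr ⟨z, Set.mem_iInter.mpr fun n => ?_⟩
  obtain ⟨p, h0, hp, hinj, hocc⟩ := hz n
  refine ⟨p, h0, hp, hinj, fun i hi => ?_⟩
  obtain ⟨l, hl⟩ := hω (p i)
  have := hocc i hi
  rw [hl] at this ⊢
  exact_mod_cast Nat.one_le_iff_ne_zero.mpr (by exact_mod_cast this)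

/-- Steps of the paths defining a Lipschitz surface of good sites: a free step going up (possibly
diagonally), or a step straight down from a bad site. -/
def LipschitzStep (bad : ℤ × ℤ → Prop) (v w : ℤ × ℤ) : Prop :=
  (bad v ∧ w = v + (0, -1)) ∨ w = v + (0, 1) ∨ w = v + (1, 1) ∨ w = v + (-1, 1)

/-- If no path of Lipschitz steps from `(0, n)` reaches height `0`, then over the nonnegative
integers there is the graph of a `1`-Lipschitz function consisting of good sites. -/
lemma exists_lipschitz_good {bad : ℤ × ℤ → Prop} {n : ℕ}
    (hn : ¬ ∃ w : ℤ × ℤ, w.2 ≤ 0 ∧ Relation.ReflTransGen (LipschitzStep bad) (0, (n : ℤ)) w) :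
    ∃ F : ℕ → ℕ, (∀ x : ℕ, ¬ bad ((x : ℤ), (F x : ℤ))) ∧
      ∀ x, F (x + 1) ≤ F x + 1 ∧ F x ≤ F (x + 1) + 1 := by
  classical
  let Rch : ℤ × ℤ → Prop := fun v =>
    ∃ w : ℤ × ℤ, w.2 ≤ 0 ∧ Relation.ReflTransGen (LipschitzStep bad) v w
  have hstep : ∀ v w, LipschitzStep bad v w → Rch w → Rch v :=
    fun v w hvw ⟨u, hu, hwu⟩ => ⟨u, hu, .head hvw hwu⟩
  have hfree : ∀ a b c : ℤ, (c = a ∨ c = a + 1 ∨ c = a - 1) → ¬ Rch (a, b) → ¬ Rch (c, b + 1) := by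
    intro a b c hc hab hcb
    refine hab (hstep _ _ (Or.inr ?_) hcb)
    rcases hc with rfl | rfl | rfl
    · left; simp
    · right; left; simp
    · right; right; simp [sub_eq_add_neg]
  have hex : ∀ x : ℕ, ∃ b : ℕ, ¬ Rch ((x : ℤ), (b : ℤ)) := by
    intro x
    induction x with
    | zero => exact ⟨n, hn⟩
    | succ x ih =>
      obtain ⟨b, hb⟩ := ih
      refine ⟨b + 1, ?_⟩
      push_cast
      exact hfree _ _ _ (Or.inr (Or.inl rfl)) hb
  refine ⟨fun x => Nat.find (hex x), fun x hbad => ?_, fun x => ⟨?_, ?_⟩⟩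
  · have h1 := Nat.find_spec (hex x)
    rcases Nat.eq_zero_or_pos (Nat.find (hex x)) with h0 | h0
    · rw [h0] at h1
      exact h1 ⟨_, le_rfl, .refl⟩
    · obtain ⟨m, hm⟩ : ∃ m, Nat.find (hex x) = m + 1 := ⟨_, (Nat.succ_pred_eq_of_pos h0).symm⟩
      have h2 := Nat.find_min (hex x) (m := m) (by omega)
      simp only [hm] at h1 hbad
      push Not at h2
      refine h1 (hstep _ _ (Or.inl ⟨hbad, rfl⟩) ?_)
      simpa using h2
  · refine Nat.find_min' _ ?_
    push_cast
    exact hfree _ _ _ (Or.inr (Or.inl rfl)) (Nat.find_spec (hex x))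
  · refine Nat.find_min' _ ?_
    push_cast
    refine hfree _ _ _ (Or.inr (Or.inr ?_)) (Nat.find_spec (hex (x + 1)))
    push_cast; ring

/-- A self-avoiding path of Lipschitz steps which descends from height `n` to height `0` has at
least `n` steps, at least half of which start at bad sites. -/
lemma exists_descending_path {bad : ℤ × ℤ → Prop} {n : ℕ}
    (hn : ∃ w : ℤ × ℤ, w.2 ≤ 0 ∧ Relation.ReflTransGen (LipschitzStep bad) (0, (n : ℤ)) w) :
    ∃ N ≥ n, ∃ p : ℕ → ℤ × ℤ, p 0 = (0, (n : ℤ)) ∧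
      (∀ i < N, p (i + 1) - p i ∈ ({(0, -1), (0, 1), (1, 1), (-1, 1)} : Finset (ℤ × ℤ))) ∧
      Set.InjOn p (Set.Iic N) ∧
      N ≤ 2 * ((Finset.range N).filter fun i => p (i + 1) - p i = (0, -1)).card ∧
      ∀ i < N, p (i + 1) - p i = (0, -1) → bad (p i) := by
  obtain ⟨w, hw, hpath⟩ := hn
  obtain ⟨N, p, h0, hN, hp, hinj⟩ := exists_injOn_path hpath
  have hdiff : ∀ i < N, (bad (p i) ∧ p (i + 1) - p i = (0, -1)) ∨ p (i + 1) - p i = (0, 1) ∨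
      p (i + 1) - p i = (1, 1) ∨ p (i + 1) - p i = (-1, 1) := by
    intro i hi
    simpa only [LipschitzStep, sub_eq_iff_eq_add'] using hp i hi
  have hheight : ∀ m ≤ N, (p m).2 +
      2 * ((Finset.range m).filter fun i => p (i + 1) - p i = (0, -1)).card = n + m := by
    intro m
    induction m with
    | zero => simp [h0]
    | succ m ih =>
      intro hm
      have h1 := ih (by omega)
      have h2 : (p (m + 1)).2 = (p m).2 + (p (m + 1) - p m).2 := by simp
      rw [Finset.range_add_one, Finset.filter_insert]
      rcases hdiff m (by omega) with h | h | h | h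
      · rw [if_pos h.2, Finset.card_insert_of_notMem (by simp), h2, h.2]
        push_cast; linarith
      all_goals
        rw [if_neg (by rw [h]; decide), h2, h]
        push_cast; linarith
  have hle : ((Finset.range N).filter fun i => p (i + 1) - p i = (0, -1)).card ≤ N := by
    simpa using Finset.card_filter_le (Finset.range N) fun i => p (i + 1) - p i = (0, -1)
  have hfin := hheight N le_rfl
  rw [hN] at hfin
  refine ⟨N, by omega, p, h0, fun i hi => ?_, hinj, by omega, fun i hi hd => ?_⟩
  · rcases hdiff i hi with h | h | h | h
    · simp [h.2]
    all_goals simp [h]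
  · rcases hdiff i hi with h | h | h | h
    · exact h.1
    all_goals rw [h] at hd; exact absurd hd (by decide)

/-- If finite sets of sites are bad with probability exponentially small in their cardinality,
with a small enough rate, a Lipschitz graph of good sites exists with positive probability. -/
lemma measure_exists_lipschitz_good_pos {Ω : Type*} [MeasurableSpace Ω] {P : Measure Ω}
    [IsProbabilityMeasure P] {bad : Ω → ℤ × ℤ → Prop}
    (hbad : ∀ T : Finset (ℤ × ℤ), P {ω | ∀ v ∈ T, bad ω v} ≤ (8⁻¹ ^ 2) ^ T.card) :
    0 < P {ω | ∃ F : ℕ → ℕ, (∀ x : ℕ, ¬ bad ω ((x : ℤ), (F x : ℤ))) ∧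
      ∀ x, F (x + 1) ≤ F x + 1 ∧ F x ≤ F (x + 1) + 1} := by
  classical
  let S : Finset (ℤ × ℤ) := {(0, -1), (0, 1), (1, 1), (-1, 1)}
  let D : ℕ → (ℕ → ℤ × ℤ) → Finset ℕ := fun N p =>
    (Finset.range N).filter fun i => p (i + 1) - p i = (0, -1)
  let A : ℕ → (ℕ → ℤ × ℤ) → Set Ω := fun N p =>
    {ω | Set.InjOn p (Set.Iic N) ∧ N ≤ 2 * (D N p).card ∧
      ∀ i < N, p (i + 1) - p i = (0, -1) → bad ω (p i)}
  have hA : ∀ N p, P (A N p) ≤ 8⁻¹ ^ N := by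
    intro N p
    by_cases h : Set.InjOn p (Set.Iic N) ∧ N ≤ 2 * (D N p).card
    · have hcard : ((D N p).image p).card = (D N p).card :=
        Finset.card_image_of_injOn (h.1.mono fun i hi => by
          have := (Finset.mem_filter.mp hi).1
          simp at this ⊢; omega)
      calc P (A N p) ≤ P {ω | ∀ v ∈ (D N p).image p, bad ω v} := by
            refine measure_mono fun ω hω v hv => ?_
            obtain ⟨i, hi, rfl⟩ := Finset.mem_image.mp hv
            obtain ⟨hi1, hi2⟩ := Finset.mem_filter.mp hi
            exact hω.2.2 i (Finset.mem_range.mp hi1) hi2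
        _ ≤ (8⁻¹ ^ 2) ^ (D N p).card := hcard ▸ hbad _
        _ = 8⁻¹ ^ (2 * (D N p).card) := (pow_mul _ _ _).symm
        _ ≤ 8⁻¹ ^ N := pow_le_pow_right_of_le_one' (by simp) h.2
    · have : A N p = ∅ := Set.eq_empty_of_forall_notMem fun ω hω => h ⟨hω.1, hω.2.1⟩
      simp [this]
  let E : ℕ → Set Ω := fun N =>
    {ω | ∃ p : ℕ → ℤ × ℤ, p 0 = (0, ((2 : ℕ) : ℤ)) ∧ (∀ i < N, p (i + 1) - p i ∈ S) ∧ ω ∈ A N p}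
  have hE : ∀ N, P (E N) ≤ 2⁻¹ ^ N := by
    intro N
    refine (measure_exists_path_le P S _ N (A N) (8⁻¹ ^ N) ?_ (hA N)).trans (le_of_eq ?_)
    · intro p q hqp ω hω
      have hD : D N q = D N p := by
        refine Finset.filter_congr fun i hi => ?_
        have := Finset.mem_range.mp hi
        rw [hqp i (by omega), hqp (i + 1) (by omega)]
      refine ⟨hω.1.congr fun i hi => (hqp i hi).symm, by rw [hD]; exact hω.2.1, fun i hi => ?_⟩
      rw [hqp i (by omega), hqp (i + 1) (by omega)]
      exact hω.2.2 i hi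
    · have hS : S.card = 4 := by decide
      rw [hS, ← mul_pow]
      congr 1
      have : (8 : ℝ≥0∞) = 4 * 2 := by norm_num
      rw [this, ENNReal.mul_inv (by simp) (by simp), ← mul_assoc, Nat.cast_ofNat,
        ENNReal.mul_inv_cancel (by simp) (by simp), one_mul]
  set G : Set Ω := {ω | ∃ F : ℕ → ℕ, (∀ x : ℕ, ¬ bad ω ((x : ℤ), (F x : ℤ))) ∧
      ∀ x, F (x + 1) ≤ F x + 1 ∧ F x ≤ F (x + 1) + 1}
  have hcover : Set.univ ⊆ G ∪ ⋃ N, E (N + 2) := by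
    intro ω _
    by_cases h : ∃ w : ℤ × ℤ, w.2 ≤ 0 ∧
        Relation.ReflTransGen (LipschitzStep (bad ω)) (0, ((2 : ℕ) : ℤ)) w
    · right
      obtain ⟨N, hN, p, h0, hp, hinj, hD, hb⟩ := exists_descending_path h
      obtain ⟨N, rfl⟩ := Nat.exists_eq_add_of_le' hN
      exact Set.mem_iUnion.mpr ⟨N, p, h0, hp, hinj, hD, hb⟩
    · exact Or.inl (exists_lipschitz_good h)
  have hsum : P (⋃ N, E (N + 2)) ≤ 2⁻¹ := by
    calc P (⋃ N, E (N + 2)) ≤ ∑' N, P (E (N + 2)) := measure_iUnion_le _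
      _ ≤ ∑' N : ℕ, (2⁻¹ : ℝ≥0∞) ^ (N + 2) := ENNReal.tsum_le_tsum fun N => hE _
      _ = 2⁻¹ := by
        simp only [pow_add, ENNReal.tsum_mul_right, ENNReal.tsum_geometric,
          ENNReal.one_sub_inv_two, inv_inv]
        rw [sq, ← mul_assoc, ENNReal.mul_inv_cancel (by simp) (by simp), one_mul]
  by_contra hG
  have hG0 : P G = 0 := by simpa using hG
  have h1 : (1 : ℝ≥0∞) ≤ 2⁻¹ := by
    calc (1 : ℝ≥0∞) = P Set.univ := measure_univ.symm
      _ ≤ P G + P (⋃ N, E (N + 2)) := (measure_mono hcover).trans (measure_union_le _ _)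
      _ ≤ 2⁻¹ := by rw [hG0, zero_add]; exact hsum
  exact absurd h1 (by simp)

/-- Index of the `j`-th of the `k` cubes forming the planar block with index `v`. -/
def blockIndex {d k : ℕ} (v : ℤ × ℤ) (j : Fin k) : Fin d → ℤ :=
  fun i => if (i : ℕ) = 0 then k * v.1 + (j : ℤ) else if (i : ℕ) = 1 then v.2 else 0

lemma eq_of_blockIndex_eq {d k : ℕ} (hd : 2 ≤ d) {v w : ℤ × ℤ} {i j : Fin k}
    (h : (blockIndex v i : Fin d → ℤ) = blockIndex w j) : v = w ∧ i = j := by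
  have h0 : (k : ℤ) * v.1 + i = k * w.1 + j := by
    simpa [blockIndex] using congrFun h ⟨0, by omega⟩
  have h1 : v.2 = w.2 := by simpa [blockIndex] using congrFun h ⟨1, by omega⟩
  have hi : (i : ℤ) < k := by exact_mod_cast i.2
  have hj : (j : ℤ) < k := by exact_mod_cast j.2
  have hk : (0 : ℤ) < k := by omega
  have h2 : v.1 = w.1 := by
    have e1 := congrArg (· / (k : ℤ)) h0
    simpa [Int.add_ediv_of_dvd_left, hk.ne', show k ≠ 0 by omega,
      Int.ediv_eq_zero_of_lt (Int.natCast_nonneg _) hi,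
      Int.ediv_eq_zero_of_lt (Int.natCast_nonneg _) hj] using e1
  refine ⟨Prod.ext h2 h1, Fin.ext ?_⟩
  rw [h2] at h0
  omega

/-- The closed box containing the `k` cubes of the block with index `v`. -/
def closedBlock {d : ℕ} (h : ℝ) (k : ℕ) (v : ℤ × ℤ) : Set (EuclideanSpace ℝ (Fin d)) :=
  {y | ∀ i : Fin d, y i ∈ if (i : ℕ) = 0 then Set.Icc (h * k * v.1) (h * k * (v.1 + 1))
    else if (i : ℕ) = 1 then Set.Icc (h * v.2) (h * (v.2 + 1)) else Set.Icc 0 h}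

lemma isPreconnected_closedBlock {d : ℕ} (h : ℝ) (k : ℕ) (v : ℤ × ℤ) :
    IsPreconnected (closedBlock h k v : Set (EuclideanSpace ℝ (Fin d))) := by
  refine Convex.isPreconnected fun x hx y hy a b ha hb hab i => ?_
  have h1 := hx i
  have h2 := hy i
  split_ifs at h1 h2 ⊢ <;> exact convex_Icc _ _ h1 h2 ha hb hab

lemma gridCell_blockIndex_subset {d k : ℕ} {h : ℝ} (hh : 0 < h) (v : ℤ × ℤ) (j : Fin k) :
    (gridCell h (blockIndex v j) : Set (EuclideanSpace ℝ (Fin d))) ⊆ closedBlock h k v := by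
  intro y hy i
  have h1 := hy i
  simp only [blockIndex] at h1
  have hj : ((j : ℕ) : ℝ) + 1 ≤ k := by exact_mod_cast j.2
  have hj0 : (0 : ℝ) ≤ (j : ℕ) := Nat.cast_nonneg _
  split_ifs at h1 ⊢
  · push_cast at h1
    constructor <;> nlinarith
  · exact ⟨h1.1, h1.2.le⟩
  · simp at h1
    exact ⟨h1.1, h1.2.le⟩

lemma closedBlock_subset_closedBall {d k : ℕ} (hk : 1 ≤ k) {h : ℝ} (hh : 0 < h) (v : ℤ × ℤ)
    {y : EuclideanSpace ℝ (Fin d)} (hy : y ∈ closedBlock h k v) :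
    closedBlock h k v ⊆ closedBall y (√d * (h * k)) := by
  intro x hx
  refine mem_closedBall.mpr (EuclideanSpace.dist_le_sqrt_mul (by positivity) fun i => ?_)
  have h1 := hx i
  have h2 := hy i
  have hk1 : (1 : ℝ) ≤ k := by exact_mod_cast hk
  have hhk : h ≤ h * k := le_mul_of_one_le_right hh.le hk1
  rw [abs_le]
  split_ifs at h1 h2 <;> constructor <;> nlinarith [h1.1, h1.2, h2.1, h2.2]

/-- A Lipschitz graph of blocks all of whose cubes are occupied makes the `k`-covered set
percolate. -/
lemma percolates_of_lipschitz_good {d k : ℕ} (hd : 2 ≤ d) (hk : 1 ≤ k) {h : ℝ} (hh : 0 < h)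
    {μ : Measure (EuclideanSpace ℝ (Fin d))} {F : ℕ → ℕ}
    (hF : ∀ x, F (x + 1) ≤ F x + 1 ∧ F x ≤ F (x + 1) + 1)
    (hgood : ∀ (x : ℕ) (j : Fin k), 1 ≤ μ (gridCell h (blockIndex ((x : ℤ), (F x : ℤ)) j))) :
    Percolates (coveredSet μ (√d * (h * k)) k) := by
  have hk0 : (0 : ℝ) < k := by exact_mod_cast hk
  let K : ℕ → Set (EuclideanSpace ℝ (Fin d)) := fun x => closedBlock h k ((x : ℤ), (F x : ℤ))
  let u : ℕ → ℝ → EuclideanSpace ℝ (Fin d) := fun x t => WithLp.toLp 2 fun i =>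
    if (i : ℕ) = 0 then h * k * x else if (i : ℕ) = 1 then t else 0
  have huK : ∀ x, u x (h * F x) ∈ K x := by
    intro x i
    simp only [u]
    split_ifs
    · simp only [Int.cast_natCast, Set.mem_Icc]
      constructor <;> nlinarith [mul_pos hh hk0]
    · simp; nlinarith
    · simp [hh.le]
  refine ⟨⋃ x, K x, ?_, ⟨⟨_, Set.mem_iUnion.mpr ⟨0, huK 0⟩⟩, ?_⟩, ?_⟩
  · refine Set.iUnion_subset fun x y hy => ?_
    have hdisj : Pairwise (Function.onFun Disjoint fun j : Fin k =>
        (gridCell h (blockIndex ((x : ℤ), (F x : ℤ)) j) : Set (EuclideanSpace ℝ (Fin d)))) :=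
      fun i j hij => disjoint_gridCell hh fun heq => hij (eq_of_blockIndex_eq hd heq).2
    calc (k : ℝ≥0∞) = ∑ _j : Fin k, 1 := by simp
      _ ≤ ∑ j : Fin k, μ (gridCell h (blockIndex ((x : ℤ), (F x : ℤ)) j)) :=
          Finset.sum_le_sum fun j _ => hgood x j
      _ = μ (⋃ j : Fin k, gridCell h (blockIndex ((x : ℤ), (F x : ℤ)) j)) := by
          rw [measure_iUnion hdisj fun j => measurableSet_gridCell _ _, tsum_fintype]
      _ ≤ μ (closedBall y (√d * (h * k))) := measure_mono <|
          (Set.iUnion_subset fun j => gridCell_blockIndex_subset hh _ j).trans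
            (closedBlock_subset_closedBall hk hh _ hy)
  · refine IsPreconnected.iUnion_of_chain (fun x => isPreconnected_closedBlock _ _ _) fun x =>
      ⟨u (x + 1) (h * max (F x : ℝ) (F (x + 1))), fun i => ?_, fun i => ?_⟩
    all_goals
      have h1 : (F (x + 1) : ℝ) ≤ F x + 1 := by exact_mod_cast (hF x).1
      have h2 : (F x : ℝ) ≤ F (x + 1) + 1 := by exact_mod_cast (hF x).2
      simp only [u, Order.succ_eq_add_one]
      split_ifs
    · simp; gcongr; linarith
    · simp only [Int.cast_natCast, Set.mem_Icc, hh, mul_le_mul_iff_right₀]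
      exact ⟨le_max_left _ _, max_le (by linarith) h1⟩
    · simp [hh.le]
    · simp only [Int.cast_natCast, Set.mem_Icc]
      push_cast
      constructor <;> nlinarith [mul_pos hh hk0]
    · simp only [Int.cast_natCast, Set.mem_Icc, hh, mul_le_mul_iff_right₀]
      exact ⟨le_max_right _ _, max_le h2 (by linarith)⟩
    · simp [hh.le]
  · intro hb
    obtain ⟨R, hR⟩ := Metric.isBounded_iff.mp hb
    obtain ⟨x, hx⟩ := exists_nat_gt (R / (h * k))
    rw [div_lt_iff₀ (by positivity)] at hx
    have h1 := hR (Set.mem_iUnion.mpr ⟨x, huK x⟩) (Set.mem_iUnion.mpr ⟨0, huK 0⟩)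
    have h2 := (le_abs_self _).trans ((EuclideanSpace.abs_sub_apply_le_dist _ _
      (⟨0, by omega⟩ : Fin d)).trans h1)
    simp [u] at h2
    linarith

/-- Supercritical bound: large cubes are rarely empty, so the `k`-covered set percolates. -/
lemma measure_percolates_pos {d k : ℕ} (hd : 2 ≤ d) (hk : 1 ≤ k) {h : ℝ} (hh : 0 < h) {m : ℝ≥0∞}
    (hm : k * m ≤ 8⁻¹ ^ 2) {Ω : Type*} [MeasurableSpace Ω] {P : Measure Ω}
    [IsProbabilityMeasure P] {Φ : Ω → Measure (EuclideanSpace ℝ (Fin d))}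
    (hcount : ∀ᵐ ω ∂P, ∀ z, ∃ n : ℕ, Φ ω (gridCell h z) = n)
    (hν : ∀ Z : Finset (Fin d → ℤ), P {ω | Φ ω (⋃ z ∈ Z, gridCell h z) = 0} ≤ m ^ Z.card) :
    0 < P {ω | Percolates (coveredSet (Φ ω) (√d * (h * k)) k)} := by
  classical
  let bad : Ω → ℤ × ℤ → Prop := fun ω v =>
    ∃ j : Fin k, Φ ω (gridCell h (blockIndex v j)) = 0
  have hbad : ∀ T : Finset (ℤ × ℤ), P {ω | ∀ v ∈ T, bad ω v} ≤ (8⁻¹ ^ 2) ^ T.card := by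
    intro T
    let Z : (T → Fin k) → Finset (Fin d → ℤ) := fun f =>
      Finset.univ.image fun v : T => blockIndex v.1 (f v)
    have hZ : ∀ f, (Z f).card = T.card := fun f => by
      rw [Finset.card_image_of_injective _ fun v w hvw =>
        Subtype.ext (eq_of_blockIndex_eq hd hvw).1]
      simp
    calc P {ω | ∀ v ∈ T, bad ω v}
        ≤ P (⋃ f : T → Fin k, {ω | Φ ω (⋃ z ∈ Z f, gridCell h z) = 0}) := by
          refine measure_mono fun ω hω => ?_
          choose f hf using fun v : T => hω v.1 v.2
          refine Set.mem_iUnion.mpr ⟨f, ?_⟩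
          refine (measure_biUnion_null_iff (Z f).countable_toSet).mpr fun z hz => ?_
          obtain ⟨v, -, rfl⟩ := Finset.mem_image.mp hz
          exact hf v
      _ ≤ ∑ f : T → Fin k, P {ω | Φ ω (⋃ z ∈ Z f, gridCell h z) = 0} :=
          measure_iUnion_fintype_le _ _
      _ ≤ ∑ _f : T → Fin k, m ^ T.card := Finset.sum_le_sum fun f _ => hZ f ▸ hν (Z f)
      _ = (k * m) ^ T.card := by simp [mul_pow]
      _ ≤ (8⁻¹ ^ 2) ^ T.card := by gcongr
  refine (measure_exists_lipschitz_good_pos hbad).trans_le (measure_mono_ae ?_)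
  filter_upwards [hcount] with ω hω hF
  obtain ⟨F, hgood, hF⟩ := hF
  refine percolates_of_lipschitz_good hd hk hh hF fun x j => ?_
  obtain ⟨l, hl⟩ := hω (blockIndex ((x : ℤ), (F x : ℤ)) j)
  have h0 : Φ ω (gridCell h (blockIndex ((x : ℤ), (F x : ℤ)) j)) ≠ 0 :=
    fun h0 => hgood x ⟨j, h0⟩
  rw [hl] at h0 ⊢
  exact_mod_cast Nat.one_le_iff_ne_zero.mpr (by exact_mod_cast h0)

/-- for a simple, stationary, weakly sub-Poisson point process `Φ` on `ℝ^d`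
(`d ≥ 2`) of intensity `λ` and any `k ≥ 1`, there are constants `c(λ) > 0` and
`c(λ,k) < ∞`, not depending on the distribution of `Φ`, with
`0 < c(λ) ≤ r_c^1(Φ) ≤ r_c^k(Φ) ≤ c(λ,k) < ∞`. -/
theorem nontrivial_phase_transition_k_percolation :
    ∀ d : ℕ, 2 ≤ d → ∀ k : ℕ, 1 ≤ k → ∀ lam : ℝ, 0 < lam →
    ∃ c c' : ℝ, 0 < c ∧
      ∀ (Ω : Type) [MeasurableSpace Ω] (P : Measure Ω) [IsProbabilityMeasure P]
        (Φ : Ω → Measure (EuclideanSpace ℝ (Fin d))),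
        Measurable Φ →
        -- `Φ` is a point process: almost surely a Radon counting measure
        (∀ᵐ ω ∂P, ∀ B : Set (EuclideanSpace ℝ (Fin d)),
          MeasurableSet B → Bornology.IsBounded B → ∃ n : ℕ, Φ ω B = n) →
        -- `Φ` is simple
        (∀ᵐ ω ∂P, ∀ x, Φ ω {x} ≤ 1) →
        -- `Φ` is stationary
        (∀ v : EuclideanSpace ℝ (Fin d),
          P.map (fun ω => (Φ ω).map (fun x => v + x)) = P.map Φ) →
        -- `Φ` has intensity `lam`
        (∀ B : Set (EuclideanSpace ℝ (Fin d)), MeasurableSet B →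
          ∫⁻ ω, Φ ω B ∂P = ENNReal.ofReal lam * volume B) →
        -- `Φ` is ν-weakly sub-Poisson
        (∀ B : Set (EuclideanSpace ℝ (Fin d)), MeasurableSet B → Bornology.IsBounded B →
          P {ω | Φ ω B = 0} ≤ ENNReal.ofReal (Real.exp (-(∫⁻ ω, Φ ω B ∂P).toReal))) →
        -- `Φ` is α-weakly sub-Poisson
        (∀ (j : ℕ) (B : Fin j → Set (EuclideanSpace ℝ (Fin d))),
          (∀ i, MeasurableSet (B i) ∧ Bornology.IsBounded (B i)) →
          Pairwise (Function.onFun Disjoint B) →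
          ∫⁻ ω, ∏ i, Φ ω (B i) ∂P ≤ ∏ i, ∫⁻ ω, Φ ω (B i) ∂P) →
        c ≤ criticalRadiusK P Φ 1 ∧
        criticalRadiusK P Φ 1 ≤ criticalRadiusK P Φ k ∧
        criticalRadiusK P Φ k ≤ c' := by
  intro d hd k hk lam hlam
  have hd0 : d ≠ 0 := by omega
  have hk0 : (0 : ℝ) < k := by exact_mod_cast hk
  obtain ⟨a, ha, ha1, hasmall⟩ : ∃ a : ℝ, 0 < a ∧ a ≤ 1 ∧ 7 ^ d * (lam * a) ≤ 2⁻¹ := by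
    refine ⟨min 1 (7 ^ d * lam * 2)⁻¹, by positivity, min_le_left _ _, ?_⟩
    calc (7 : ℝ) ^ d * (lam * min 1 (7 ^ d * lam * 2)⁻¹)
        ≤ 7 ^ d * (lam * (7 ^ d * lam * 2)⁻¹) := by gcongr; exact min_le_right _ _
      _ = 2⁻¹ := by field_simp
  obtain ⟨b, hb1, hblarge⟩ : ∃ b : ℝ, 1 ≤ b ∧ k * Real.exp (-(lam * b)) ≤ 64⁻¹ := by
    refine ⟨max 1 (Real.log (64 * k) / lam), le_max_left _ _, ?_⟩
    have h1 : Real.log (64 * k) ≤ lam * max 1 (Real.log (64 * k) / lam) :=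
      (div_le_iff₀' hlam).mp (le_max_right _ _)
    calc k * Real.exp (-(lam * max 1 (Real.log (64 * k) / lam)))
        ≤ k * Real.exp (-Real.log (64 * k)) := by gcongr
      _ = 64⁻¹ := by
        rw [Real.exp_neg, Real.exp_log (by positivity)]
        field_simp
  have hb : 0 < b := by linarith
  refine ⟨a, √d * (b * k), ha, ?_⟩
  intro Ω _ P _ Φ hΦ hcount _ _ hint hν hα
  have hcount' : ∀ h : ℝ, 0 < h → ∀ᵐ ω ∂P, ∀ z, ∃ n : ℕ, Φ ω (gridCell h z) = n := by
    intro h hh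
    filter_upwards [hcount] with ω hω z
    exact hω _ (measurableSet_gridCell h z) (isBounded_gridCell hh z)
  have hmean : ∀ h : ℝ, 0 < h → ∀ z,
      ∫⁻ ω, Φ ω (gridCell h z) ∂P = ENNReal.ofReal (lam * h ^ d) := by
    intro h hh z
    rw [hint _ (measurableSet_gridCell h z), volume_gridCell hh, ← ENNReal.ofReal_mul hlam.le]
  have hsub : ∀ r < a, P {ω | Percolates (coveredSet (Φ ω) r 1)} = 0 := by
    intro r hr
    refine measure_percolates_eq_zero ha hr (m := ENNReal.ofReal (lam * a ^ d)) ?_ hΦ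
      (hcount' a ha) fun n z hz => ?_
    · rw [← ENNReal.ofReal_ofNat, ← ENNReal.ofReal_pow (by norm_num),
        ← ENNReal.ofReal_mul (by positivity), ← ENNReal.ofReal_ofNat,
        ← ENNReal.ofReal_inv_of_pos (by norm_num)]
      refine ENNReal.ofReal_le_ofReal (le_trans ?_ hasmall)
      gcongr
      exact pow_le_of_le_one ha.le ha1 hd0
    · refine (hα n (fun i => gridCell a (z i))
        (fun i => ⟨measurableSet_gridCell _ _, isBounded_gridCell ha _⟩)
        fun i j hij => disjoint_gridCell ha (hz.ne hij)).trans (le_of_eq ?_)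
      simp [hmean a ha]
  have hsuper : 0 < P {ω | Percolates (coveredSet (Φ ω) (√d * (b * k)) k)} := by
    refine measure_percolates_pos hd hk hb (m := ENNReal.ofReal (Real.exp (-(lam * b ^ d)))) ?_
      (hcount' b hb) fun Z => ?_
    · have h8 : (8⁻¹ ^ 2 : ℝ≥0∞) = ENNReal.ofReal (64⁻¹) := by
        rw [ENNReal.ofReal_inv_of_pos (by norm_num), ← ENNReal.inv_pow]
        norm_num
      rw [h8, ← ENNReal.ofReal_natCast, ← ENNReal.ofReal_mul hk0.le]
      refine ENNReal.ofReal_le_ofReal (le_trans ?_ hblarge)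
      gcongr
      exact le_self_pow₀ hb1 hd0
    · have hmeas : MeasurableSet (⋃ z ∈ Z, (gridCell b z : Set (EuclideanSpace ℝ (Fin d)))) :=
        Z.measurableSet_biUnion fun z _ => measurableSet_gridCell b z
      have hvol : volume (⋃ z ∈ Z, (gridCell b z : Set (EuclideanSpace ℝ (Fin d)))) =
          Z.card * ENNReal.ofReal (b ^ d) := by
        rw [measure_biUnion_finset (fun z _ w _ hzw => disjoint_gridCell hb hzw)
          fun z _ => measurableSet_gridCell b z]
        simp [volume_gridCell hb]
      refine (hν _ hmeas ((Bornology.isBounded_biUnion_finset Z).mpr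
        fun z _ => isBounded_gridCell hb z)).trans (le_of_eq ?_)
      rw [hint _ hmeas, hvol, ← ENNReal.ofReal_pow (Real.exp_pos _).le, ← Real.exp_nat_mul]
      congr 2
      simp only [ENNReal.toReal_mul, ENNReal.toReal_natCast, ENNReal.toReal_ofReal hlam.le,
        ENNReal.toReal_ofReal (pow_nonneg hb.le d)]
      ring
  have hmono : {r : ℝ | 0 < P {ω | Percolates (coveredSet (Φ ω) r k)}} ⊆
      {r : ℝ | 0 < P {ω | Percolates (coveredSet (Φ ω) r 1)}} := by
    intro r hr
    refine lt_of_lt_of_le hr (measure_mono ?_)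
    rintro ω ⟨C, hC, hC'⟩
    refine ⟨C, fun y hy => ?_, hC'⟩
    exact (Nat.cast_le (α := ℝ≥0∞).mpr hk).trans (hC hy)
  have hlower : ∀ r ∈ {r : ℝ | 0 < P {ω | Percolates (coveredSet (Φ ω) r 1)}}, a ≤ r := by
    intro r hr
    by_contra! hra
    exact (ne_of_gt hr) (hsub r hra)
  exact ⟨le_csInf ⟨_, hmono hsuper⟩ hlower, csInf_le_csInf ⟨a, hlower⟩ ⟨_, hsuper⟩ hmono,
    csInf_le ⟨a, fun r hr => hlower r (hmono hr)⟩ hsuper⟩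
end
end
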